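/- Let d ≥ 4, fix an appropriate family (ρ_n) and parameters k, K, M > 0 and θ_1, θ_2 ∈ (0,1). Set l_n = ⌊R_n^{1−c/4}⌋ for d ≥ 5 and l_n = ⌊R_n·log^{-2c}R_n⌋ for d = 4, and t_n = ⌊R_n^{2−c}⌋ for d ≥ 5 and t_n = ⌊R_n²·log^{-10}R_n⌋ for d = 4. Then for all sufficiently large n, for every typical trajectory η ∈ 𝒯_n and every x in the *-proper part η̂, there is a coupling ℚ of X¹ ∼ P^x[X ∈ · | H̃_{range(η)} = ∞] and X² ∼ P^x such that the event E = { |X¹_j − X²_j|_∞ ≤ l_n for all j ≥ 0 } ∩ { X¹_{t_n+j} − X¹_{t_n} = X²_{t_n+j} − X²_{t_n} for all j ≥ 0 } satisfies ℚ[E] ≥ 1 − R_n^{−c/2} if d ≥ 5, and ℚ[E] ≥ 1 − 2θ_1 if d = 4. -/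

import Mathlib

open MeasureTheory ProbabilityTheory Filter Topology
open scoped ENNReal NNReal Classical

noncomputable section

namespace FRIPaper

/-- The lattice `ℤ^d`. -/
abbrev Zd (d : ℕ) := Fin d → ℤ

/-- `x` and `y` are nearest neighbours in `ℤ^d` (`ℓ¹`-distance one). -/
def IsNN {d : ℕ} (x y : Zd d) : Prop := (∑ i, (x i - y i).natAbs) = 1

/-- Event that a one-sided path never visits `A` at a positive time
(i.e. `H̃_A = ∞` for the path started anywhere). -/
def NoReturn {d : ℕ} (A : Set (Zd d)) : Set (ℕ → Zd d) := {ω | ∀ t : ℕ, 0 < t → ω t ∉ A}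

/-- Event that a one-sided path does not visit `A` at a positive time `t ≤ s`
(i.e. `H̃_A > s`). -/
def NoReturnUpTo {d : ℕ} (A : Set (Zd d)) (s : ℝ) : Set (ℕ → Zd d) :=
  {ω | ∀ t : ℕ, 0 < t → (t : ℝ) ≤ s → ω t ∉ A}

/-- Specification of the law `P^x` of the discrete-time simple random walk on `ℤ^d`
started at `x`, as a measure on the path space `ℕ → ℤ^d`: it is the unique probability
measure giving each nearest-neighbour cylinder of length `T` based at `x`
probability `(2d)^{-T}`. -/
def IsSRW (d : ℕ) (x : Zd d) (P : Measure (ℕ → Zd d)) : Prop :=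
  IsProbabilityMeasure P ∧
    ∀ (T : ℕ) (w : ℕ → Zd d),
      P {ω | ∀ t ≤ T, ω t = w t} =
        if w 0 = x ∧ ∀ t < T, IsNN (w t) (w (t + 1)) then
          (((2 * d : ℕ) : ℝ≥0∞))⁻¹ ^ T else 0

/-- A family `P x`, `x ∈ ℤ^d`, of simple random walk laws. -/
def IsSRWFamily (d : ℕ) (P : Zd d → Measure (ℕ → Zd d)) : Prop := ∀ x, IsSRW d x (P x)

/-- Equilibrium measure `e_A(x) = P^x[H̃_A = ∞] 1_{x ∈ A}`. -/
def equil {d : ℕ} (P : Zd d → Measure (ℕ → Zd d)) (A : Set (Zd d)) (x : Zd d) : ℝ :=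
  if x ∈ A then (P x (NoReturn A)).toReal else 0

/-- Capacity `cap(A) = Σ_{x∈A} e_A(x)`. -/
def capacity {d : ℕ} (P : Zd d → Measure (ℕ → Zd d)) (A : Finset (Zd d)) : ℝ :=
  ∑ x ∈ A, equil P (↑A) x

/-- Truncated capacity `cap(A,T) = Σ_{x∈A} P^x[H̃_A > T·(log T)^{-10}]`. -/
def capTrunc {d : ℕ} (P : Zd d → Measure (ℕ → Zd d)) (A : Finset (Zd d)) (T : ℝ) : ℝ :=
  ∑ x ∈ A, (P x (NoReturnUpTo (↑A) (T / (Real.log T) ^ (10 : ℕ)))).toReal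

/-- `X[a,b]`, the set of points visited by the path between times `a` and `b`. -/
def walkRange {d : ℕ} (ω : ℕ → Zd d) (a b : ℕ) : Finset (Zd d) := (Finset.Icc a b).image ω

/-- `E^0[cap(X[0,T])]`. -/
def capExpect {d : ℕ} (P : Zd d → Measure (ℕ → Zd d)) (T : ℕ) : ℝ :=
  ∫ ω, capacity P (walkRange ω 0 T) ∂ (P 0)

/-- `1 + log x · 1_{d = 4}`. -/
def logFour (d : ℕ) (x : ℝ) : ℝ := 1 + if d = 4 then Real.log x else 0

/-- `ε` is the constant `ε_d = lim_{T→∞} E^0[cap(X[0,T])]·T^{-1}·(1 + log T·1_{d=4})`,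
which lies in `(0,∞)`. -/
def IsCapLimit (d : ℕ) (P : Zd d → Measure (ℕ → Zd d)) (ε : ℝ) : Prop :=
  0 < ε ∧ Tendsto (fun T : ℕ => capExpect P T * logFour d T / (T : ℝ)) atTop (𝓝 ε)

/-! ### Distributions on `ℕ` -/

/-- `ρ` is a probability distribution on `ℕ`. -/
def IsDist (ρ : ℕ → ℝ) : Prop := (∀ k, 0 ≤ ρ k) ∧ HasSum ρ 1

/-- `k`-th moment `μ_k(ρ)`. -/
def mu (k : ℕ) (ρ : ℕ → ℝ) : ℝ := ∑' l : ℕ, (l : ℝ) ^ k * ρ l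

/-- Tail `μ_k^{(m)}(ρ) = Σ_{l ≥ m} l^k ρ(l)`. -/
def muTail (k m : ℕ) (ρ : ℕ → ℝ) : ℝ := ∑' l : ℕ, if m ≤ l then (l : ℝ) ^ k * ρ l else 0

/-- An appropriate family of distributions on `ℕ`. -/
def Appropriate (ρ : ℕ → ℕ → ℝ) : Prop :=
  (∀ n, IsDist (ρ n)) ∧
  (∀ n, Summable fun l : ℕ => (l : ℝ) ^ 2 * ρ n l) ∧
  Tendsto (fun n => mu 1 (ρ n)) atTop atTop ∧
  ∀ ε : ℝ, 0 < ε → ∃ C : ℝ,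
    ∀ n, (∑' L : ℕ, if C * mu 1 (ρ n) ≤ (L : ℝ) then (L : ℝ) ^ 2 * ρ n L / mu 2 (ρ n) else 0) ≤ ε

/-- Geometric distribution `Geo(λ)(k) = λ (1-λ)^k`. -/
def geo (lam : ℝ) (k : ℕ) : ℝ := lam * (1 - lam) ^ k

/-! ### Trajectories and finitary random interlacements -/

/-- A finite trajectory in `ℤ^d`, recorded as the list of its positions. -/
abbrev Traj (d : ℕ) := List (Zd d)

/-- A point configuration: the multiplicity of each trajectory. -/
abbrev Config (d : ℕ) := Traj d → ℕ

/-- A valid trajectory: a nonempty nearest-neighbour path. -/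
def ValidTraj {d : ℕ} (η : Traj d) : Prop := η ≠ [] ∧ η.Chain' IsNN

/-- The time length `T(η)` of a trajectory. -/
def len {d : ℕ} (η : Traj d) : ℕ := η.length - 1

/-- The range of a trajectory, as a set. -/
def rangeSet {d : ℕ} (η : Traj d) : Set (Zd d) := {y | y ∈ η}

/-- The trajectory `η` visits the set `A`. -/
def hits {d : ℕ} (η : Traj d) (A : Set (Zd d)) : Prop := ∃ y ∈ η, y ∈ A

/-- Poisson probability mass `e^{-r} r^n / n!`. -/
def poissonProb (r : ℝ) (n : ℕ) : ℝ≥0∞ :=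
  ENNReal.ofReal (Real.exp (-r) * r ^ n / n.factorial)

/-- The intensity `u·π({η})` that FRI with parameters `(u,ρ)` puts on a single
trajectory `η`: trajectories of length `l` from each starting point carry mass
`u·ρ(l)/(μ₁(ρ)+1)·(2d)^{-l}` each. -/
def friIntensity (d : ℕ) (u : ℝ) (ρ : ℕ → ℝ) (η : Traj d) : ℝ :=
  if ValidTraj η then u * ρ (len η) / (mu 1 ρ + 1) * (1 / (2 * (d : ℝ))) ^ (len η) else 0

/-- `P` is the law of a Poisson point process on the countable set of trajectories
with intensity function `ι`: the multiplicities of distinct trajectories are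
independent Poisson random variables. -/
def IsPoissonPP (d : ℕ) (ι : Traj d → ℝ) (P : Measure (Config d)) : Prop :=
  IsProbabilityMeasure P ∧
    ∀ (F : Finset (Traj d)) (k : Traj d → ℕ),
      P {ω | ∀ η ∈ F, ω η = k η} = ∏ η ∈ F, poissonProb (ι η) (k η)

/-- `P` is the law of the finitary random interlacements point process `𝒳^{u,ρ}`. -/
def IsFRI (d : ℕ) (u : ℝ) (ρ : ℕ → ℝ) (P : Measure (Config d)) : Prop :=
  IsPoissonPP d (friIntensity d u ρ) P

/-- `J` is the law of an i.i.d. sequence of copies of `𝒳^{u,ρ}`. -/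
def IsFRIseq (d : ℕ) (u : ℝ) (ρ : ℕ → ℝ) (J : Measure (ℕ → Config d)) : Prop :=
  IsProbabilityMeasure J ∧
    ∀ (F : Finset (ℕ × Traj d)) (k : ℕ × Traj d → ℕ),
      J {j | ∀ p ∈ F, j p.1 p.2 = k p} = ∏ p ∈ F, poissonProb (friIntensity d u ρ p.2) (k p)

/-! ### Percolation -/

/-- The edge `{x,y}` is traversed by some trajectory of the configuration `ω`. -/
def EdgeOpen {d : ℕ} (ω : Config d) (x y : Zd d) : Prop :=
  ∃ η : Traj d, 0 < ω η ∧ ∃ i : ℕ,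
    (η[i]? = some x ∧ η[i + 1]? = some y) ∨ (η[i]? = some y ∧ η[i + 1]? = some x)

/-- The cluster of `x` in the subgraph `ℐ` induced by the configuration `ω`. -/
def Cluster {d : ℕ} (ω : Config d) (x : Zd d) : Set (Zd d) :=
  {y | Relation.ReflTransGen (EdgeOpen ω) x y}

/-- The origin lies in an infinite cluster. -/
def PercEvent (d : ℕ) : Set (Config d) := {ω | (Cluster ω 0).Infinite}

/-- The critical intensity `u_*(ρ)`, given the family `u ↦ 𝒳^{u,ρ}`. -/
def uStar (d : ℕ) (X : ℝ → Measure (Config d)) : ℝ :=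
  sInf {u : ℝ | 0 ≤ u ∧ 0 < X u (PercEvent d)}

/-- The order `u_n = μ₁(ρ)·(1 + log μ₁(ρ)·1_{d=4}) / (ε_d·μ₂(ρ))` of the
critical intensity. -/
def uN (d : ℕ) (εd : ℝ) (ρ : ℕ → ℝ) : ℝ :=
  mu 1 ρ * logFour d (mu 1 ρ) / (εd * mu 2 ρ)

/-! ### `ρ`-capacity, Green function, `κ` and `φ` -/

/-- `e_A^{(ρ)}(x) = Σ_m (μ₀^{(m)}(ρ)/(μ₁(ρ)+1))·P^x[H̃_A > m]`. -/
def equilRho {d : ℕ} (P : Zd d → Measure (ℕ → Zd d)) (ρ : ℕ → ℝ) (A : Set (Zd d))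
    (x : Zd d) : ℝ :=
  ∑' m : ℕ, (muTail 0 m ρ / (mu 1 ρ + 1)) * (P x (NoReturnUpTo A (m : ℝ))).toReal

/-- `cap^{(ρ)}(A) = Σ_{x∈A} e_A^{(ρ)}(x)`. -/
def capRho {d : ℕ} (P : Zd d → Measure (ℕ → Zd d)) (ρ : ℕ → ℝ) (A : Finset (Zd d)) : ℝ :=
  ∑ x ∈ A, equilRho P ρ (↑A) x

/-- Green's function `g(x,y) = Σ_t P^x[X_t = y]`. -/
def green {d : ℕ} (P : Zd d → Measure (ℕ → Zd d)) (x y : Zd d) : ℝ :=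
  ∑' t : ℕ, (P x {ω | ω t = y}).toReal

/-- `φ^{(ρ)}(A,B) = Σ_{x∈A} Σ_{y∈B} e_A^{(ρ)}(x) e_B^{(ρ)}(y) g(x,y)`. -/
def phiRho {d : ℕ} (P : Zd d → Measure (ℕ → Zd d)) (ρ : ℕ → ℝ) (A B : Finset (Zd d)) : ℝ :=
  ∑ x ∈ A, ∑ y ∈ B, equilRho P ρ (↑A) x * equilRho P ρ (↑B) y * green P x y

/-- `κ^{(ρ)}(A) = Σ_{x∈A} Σ_m (μ₁^{(m)}(ρ)/μ₂(ρ))·P^x[H̃_A > m]` (real-valued,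
for finite `A`). -/
def kappa {d : ℕ} (P : Zd d → Measure (ℕ → Zd d)) (ρ : ℕ → ℝ) (A : Finset (Zd d)) : ℝ :=
  ∑ x ∈ A, ∑' m : ℕ, (muTail 1 m ρ / mu 2 ρ) * (P x (NoReturnUpTo (↑A) (m : ℝ))).toReal

/-- `κ^{(ρ)}(A)` as an extended-real valued quantity, for arbitrary `A`. -/
def kappaE {d : ℕ} (P : Zd d → Measure (ℕ → Zd d)) (ρ : ℕ → ℝ) (A : Set (Zd d)) : ℝ≥0∞ :=
  ∑' x : Zd d,
    A.indicator (fun x => ∑' m : ℕ,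
      ENNReal.ofReal (muTail 1 m ρ / mu 2 ρ) * P x (NoReturnUpTo A (m : ℝ))) x

/-! ### Exploration processes -/

/-- First components: the `k`-th layer `L_k` of vertices; second components:
`∪_{i<k} L_i`.  Layer `L_{k+1}` is spanned by the trajectories of `ω` meeting `L_k`
but not `∪_{i<k} L_i`. -/
def exploreSets {d : ℕ} (ω : Config d) : ℕ → Set (Zd d) × Set (Zd d)
  | 0 => ({0}, ∅)
  | k + 1 =>
    ({y | ∃ η : Traj d, 0 < ω η ∧ hits η (exploreSets ω k).1 ∧
        ¬ hits η (exploreSets ω k).2 ∧ y ∈ η},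
      (exploreSets ω k).1 ∪ (exploreSets ω k).2)

/-- The `i`-th layer `𝓛_i` of trajectories of the exploration of the cluster of the
origin, as a sub-configuration of `ω`. -/
def exploreLayer {d : ℕ} (ω : Config d) : ℕ → Config d
  | 0 => fun _ => 0
  | k + 1 => fun η =>
      if hits η (exploreSets ω k).1 ∧ ¬ hits η (exploreSets ω k).2 then ω η else 0

/-- The vertex sets `L'_k` of the dominating exploration driven by the i.i.d.
sequence `j`. -/
def exploreSets' {d : ℕ} (j : ℕ → Config d) : ℕ → Set (Zd d)
  | 0 => {0}
  | k + 1 => {y | ∃ η : Traj d, 0 < j (k + 1) η ∧ hits η (exploreSets' j k) ∧ y ∈ η}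

/-- The trajectory layers `𝓛'_i` of the dominating exploration. -/
def exploreLayer' {d : ℕ} (j : ℕ → Config d) : ℕ → Config d
  | 0 => fun _ => 0
  | k + 1 => fun η => if hits η (exploreSets' j k) then j (k + 1) η else 0

/-- `W_k = 𝔼[κ^{(ρ)}(L'_k)]`. -/
def Wexp {d : ℕ} (P : Zd d → Measure (ℕ → Zd d)) (ρ : ℕ → ℝ)
    (J : Measure (ℕ → Config d)) (k : ℕ) : ℝ≥0∞ :=
  ∫⁻ j, kappaE P ρ (exploreSets' j k) ∂ J

/-- `V_k = 𝔼[|L'_k|]`, multiplied by `(log μ₁(ρ))⁻¹` when `d = 4`. -/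
def Vexp (d : ℕ) (ρ : ℕ → ℝ) (J : Measure (ℕ → Config d)) (k : ℕ) : ℝ≥0∞ :=
  (if d = 4 then ENNReal.ofReal (1 / Real.log (mu 1 ρ)) else 1) *
    ∫⁻ j, ENat.toENNReal (exploreSets' j k).encard ∂ J

/-! ### Two-sided finite random walk trajectories -/

/-- `μ(x,m,l)({η})`: the two-sided path `(X_{-m},…,X_l)` of a doubly infinite walk
with `X_0 = x` equals the list `η` (of length `m+l+1`, with `η[m] = x`)
with probability `(2d)^{-(m+l)}` for every admissible nearest-neighbour list. -/
def twoSidedProb (d : ℕ) (x : Zd d) (m l : ℕ) (η : Traj d) : ℝ :=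
  if η.length = m + l + 1 ∧ η.Chain' IsNN ∧ η[m]? = some x then
    (1 / (2 * (d : ℝ))) ^ (m + l) else 0

/-- The `ℓ^∞`-diameter of the range of `η` is at most `R`. -/
def DiamLE {d : ℕ} (η : Traj d) (R : ℝ) : Prop :=
  ∀ a ∈ η, ∀ b ∈ η, ∀ i, |((a i - b i : ℤ) : ℝ)| ≤ R

/-- `P^x[X[-m,-1] ∩ A = ∅]`: the probability that an `m`-step walk from `x`
avoids `A` at all positive times, written combinatorially. -/
def backAvoidProb (d : ℕ) (A : Set (Zd d)) (x : Zd d) (m : ℕ) : ℝ :=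
  ∑' w : Traj d,
    if w.length = m + 1 ∧ w.Chain' IsNN ∧ w[0]? = some x ∧
        (∀ i : ℕ, 0 < i → ∀ y, w[i]? = some y → y ∉ A) then
      (1 / (2 * (d : ℝ))) ^ m else 0

/-- `μ(x,m,l;A)({η}) = P^x[X[-m,l] = η | X[-m,-1] ∩ A = ∅]`. -/
def condTwoSidedProb (d : ℕ) (A : Set (Zd d)) (x : Zd d) (m l : ℕ) (η : Traj d) : ℝ :=
  (if ∀ i < m, ∀ y, η[i]? = some y → y ∉ A then twoSidedProb d x m l η else 0) /
    backAvoidProb d A x m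

/-- `π_A({η}) = Σ_{x∈A} Σ_{m,l} (ρ(m+l)/(μ₁(ρ)+1))·P^x[H̃_A > m]·μ(x,m,l;A)({η})`. -/
def piA (d : ℕ) (P : Zd d → Measure (ℕ → Zd d)) (ρ : ℕ → ℝ) (A : Finset (Zd d))
    (η : Traj d) : ℝ :=
  ∑ x ∈ A, ∑' m : ℕ, ∑' l : ℕ,
    ρ (m + l) / (mu 1 ρ + 1) * (P x (NoReturnUpTo (↑A) (m : ℝ))).toReal *
      condTwoSidedProb d (↑A) x m l η

/-- The sub-configuration of trajectories meeting `A`, i.e. `𝒳[A]`. -/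
def restrictConfig {d : ℕ} (A : Finset (Zd d)) (ω : Config d) : Config d :=
  fun η => if hits η (↑A) then ω η else 0

/-! ### Products and geometric laws -/

/-- The geometric measure `Geo(1/(T+1))` on `ℕ`. -/
def geoMeasure (T : ℕ) : Measure ℕ :=
  Measure.sum fun k : ℕ => (ENNReal.ofReal (geo (1 / ((T : ℝ) + 1)) k)) • Measure.dirac k

/-- `Q` is the product (independent coupling) of `μ` and `ν`. -/
def IsProdOf {α β : Type*} [MeasurableSpace α] [MeasurableSpace β]
    (Q : Measure (α × β)) (μ : Measure α) (ν : Measure β) : Prop :=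
  IsProbabilityMeasure Q ∧
    ∀ (A : Set α) (B : Set β), MeasurableSet A → MeasurableSet B → Q (A ×ˢ B) = μ A * ν B

/-! ### Coarse graining quantities -/

/-- The constant `c = 0.01`. -/
def cConst : ℝ := 0.01

/-- `R_n = ⌊√(μ₁(ρ_n))⌋`. -/
def Rn (ρ : ℕ → ℕ → ℝ) (n : ℕ) : ℕ := ⌊Real.sqrt (mu 1 (ρ n))⌋₊

/-- The mesoscopic scale `L_n`. -/
def Ln (d : ℕ) (ρ : ℕ → ℕ → ℝ) (n : ℕ) : ℝ :=
  if d = 4 then (Rn ρ n : ℝ) * (Real.log (Rn ρ n)) ^ (-cConst)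
  else (Rn ρ n : ℝ) ^ ((2 + cConst) / ((d : ℝ) - 2))

/-- The slowly growing factor `I_n`. -/
def In (d : ℕ) (ρ : ℕ → ℕ → ℝ) (n : ℕ) : ℝ :=
  if d = 4 then (Real.log (Rn ρ n)) ^ cConst else (Rn ρ n : ℝ) ^ cConst

/-- The scale `T'_n`. -/
def Tn' (d : ℕ) (ρ : ℕ → ℕ → ℝ) (n : ℕ) : ℕ :=
  if d = 4 then ⌊(Rn ρ n : ℝ) ^ (2 : ℕ) / Real.log (mu 1 (ρ n))⌋₊
  else ⌊(Rn ρ n : ℝ) ^ ((2 : ℝ) - cConst / 4)⌋₊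

/-- The scale `l_n`. -/
def lnPar (d : ℕ) (ρ : ℕ → ℕ → ℝ) (n : ℕ) : ℕ :=
  if d = 4 then ⌊(Rn ρ n : ℝ) * (Real.log (Rn ρ n)) ^ (-(2 * cConst))⌋₊
  else ⌊(Rn ρ n : ℝ) ^ ((1 : ℝ) - cConst / 4)⌋₊

/-- The scale `t_n`. -/
def tnPar (d : ℕ) (ρ : ℕ → ℕ → ℝ) (n : ℕ) : ℕ :=
  if d = 4 then ⌊(Rn ρ n : ℝ) ^ (2 : ℕ) / (Real.log (Rn ρ n)) ^ (10 : ℕ)⌋₊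
  else ⌊(Rn ρ n : ℝ) ^ ((2 : ℝ) - cConst)⌋₊

/-- `y` is within `ℓ^∞`-distance `r` of `z`. -/
def InBall {d : ℕ} (y z : Zd d) (r : ℝ) : Prop := ∀ i, |((y i - z i : ℤ) : ℝ)| ≤ r

/-- The `ℓ^∞` `r`-neighbourhood `B(A,r)`. -/
def nbhd {d : ℕ} (A : Set (Zd d)) (r : ℝ) : Set (Zd d) := {y | ∃ z ∈ A, InBall y z r}

/-- The sub-path `η[a, b]` of a trajectory. -/
def segment {d : ℕ} (η : Traj d) (a b : ℕ) : Traj d := (η.drop a).take (b - a + 1)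

/-- `η` is a typical trajectory (the event `𝒯_n = ℰ₁ ∩ ℰ₂ ∩ ℰ₃ ∩ ℰ₄`). -/
def Typical (d : ℕ) (P : Zd d → Measure (ℕ → Zd d)) (εd : ℝ) (ρ : ℕ → ℕ → ℝ)
    (kk KK M θ1 : ℝ) (n : ℕ) (η : Traj d) : Prop :=
  ValidTraj η ∧
  -- ℰ₁
  (kk * (Rn ρ n : ℝ) ^ 2 ≤ (len η : ℝ) ∧ (len η : ℝ) ≤ KK * (Rn ρ n : ℝ) ^ 2 ∧
    ∀ y ∈ η, InBall y η.headI (M * (Rn ρ n : ℝ))) ∧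
  -- ℰ₂
  (if d = 4 then
    (1 - θ1 ^ 2) * (Real.pi ^ 2 / 8) * (len η : ℝ) / Real.log (mu 1 (ρ n)) <
        capacity P η.toFinset ∧
      capTrunc P η.toFinset ((Rn ρ n : ℝ) ^ 2) <
        (1 + θ1 ^ 2) * (Real.pi ^ 2 / 8) * (len η : ℝ) / Real.log (mu 1 (ρ n))
  else
    (1 - θ1 ^ 2) * εd * (len η : ℝ) < capacity P η.toFinset ∧
      capacity P η.toFinset < (1 + θ1 ^ 2) * εd * (len η : ℝ)) ∧
  -- ℰ₃
  ((Set.ncard (nbhd (rangeSet η) (Ln d ρ n)) : ℝ) <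
    (Rn ρ n : ℝ) ^ 2 * (Ln d ρ n) ^ (d - 2) * (In d ρ n) ^ ((1 : ℝ) / 3)) ∧
  -- ℰ₄
  (∀ j : ℕ, j * Tn' d ρ n ≤ len η →
    if d = 4 then
      capacity P (segment η (j * Tn' d ρ n) (min ((j + 1) * Tn' d ρ n) (len η))).toFinset ≤
          (1 + θ1 ^ 2) * (Real.pi ^ 2 / 8) * (Tn' d ρ n : ℝ) / Real.log (mu 1 (ρ n)) ∧
        ∀ a ∈ segment η (j * Tn' d ρ n) (min ((j + 1) * Tn' d ρ n) (len η)),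
          ∀ b ∈ segment η (j * Tn' d ρ n) (min ((j + 1) * Tn' d ρ n) (len η)),
            ∀ i, |((a i - b i : ℤ) : ℝ)| <
              (1 / 2) * Real.sqrt (len η : ℝ) * (Real.log (mu 1 (ρ n))) ^ (-cConst)
    else
      capacity P (segment η (j * Tn' d ρ n) (min ((j + 1) * Tn' d ρ n) (len η))).toFinset ≤
        (1 + θ1 ^ 2) * εd * (Tn' d ρ n : ℝ))

/-- `x` belongs to the `*`-proper part `η̂` of the trajectory `η`. -/
def ProperStar (d : ℕ) (P : Zd d → Measure (ℕ → Zd d)) (ρ : ℕ → ℕ → ℝ)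
    (θ1 θ2 : ℝ) (n : ℕ) (η : Traj d) (x : Zd d) : Prop :=
  x ∈ rangeSet η ∧
    (if d = 4 then
      θ2 / Real.log (mu 1 (ρ n)) ≤ equil P (rangeSet η) x ∧
        (P x (NoReturnUpTo (rangeSet η)
            ((Rn ρ n : ℝ) ^ 2 / (Real.log (Rn ρ n)) ^ (10 : ℕ)))).toReal ≤
          (1 + θ1) * equil P (rangeSet η) x
    else θ2 ≤ equil P (rangeSet η) x)

/-! ### One-dimensional heat kernel -/

/-- One-dimensional simple random walk heat kernel. -/
def hk1 : ℕ → ℤ → ℝ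
  | 0 => fun y => if y = 0 then 1 else 0
  | n + 1 => fun y => (hk1 n (y - 1) + hk1 n (y + 1)) / 2

theorem hk1_nonneg (n : ℕ) (y : ℤ) : 0 ≤ hk1 n y := by
  induction n generalizing y with
  | zero => simp only [hk1]; split_ifs <;> norm_num
  | succ n ih => simp only [hk1]; have := ih (y-1); have := ih (y+1); linarith

theorem hk1_formula (n : ℕ) : (∀ k : ℕ, hk1 n (2 * k - n) = (n.choose k : ℝ) / 2 ^ n) ∧
    (∀ y : ℤ, (∀ k : ℕ, y ≠ 2 * k - n) → hk1 n y = 0) := by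
  induction n with
  | zero =>
    refine ⟨fun k => ?_, fun y hy => ?_⟩
    · simp only [hk1]
      rcases k with _ | k
      · simp
      · have : ¬ ((2 * ((k + 1 : ℕ) : ℤ) - ((0 : ℕ) : ℤ)) = 0) := by push_cast; omega
        rw [if_neg this]; simp
    · have := hy 0
      simp only [hk1]
      rw [if_neg]
      simpa using this
  | succ n ih =>
    obtain ⟨ih1, ih2⟩ := ih
    refine ⟨fun k => ?_, fun y hy => ?_⟩
    · simp only [hk1]
      have e2 : (2 * (k : ℤ) - ((n + 1 : ℕ) : ℤ) + 1) = 2 * (k : ℤ) - n := by push_cast; ring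
      rw [e2, ih1 k]
      rcases k with _ | k
      · rw [ih2]
        · simp [pow_succ]; field_simp
        · intro k; push_cast; omega
      · have e1 : (2 * ((k + 1 : ℕ) : ℤ) - ((n + 1 : ℕ) : ℤ) - 1) = 2 * (k : ℤ) - n := by
          push_cast; ring
        rw [e1, ih1 k, Nat.choose_succ_succ]
        push_cast
        rw [pow_succ]; field_simp
    · simp only [hk1]
      rw [ih2, ih2]
      · simp
      · intro k hk
        exact hy k (by push_cast; omega)
      · intro k hk
        exact hy (k + 1) (by push_cast; omega)

theorem centralBinom_sq_bound (m : ℕ) : (2 * m + 1) * (Nat.centralBinom m) ^ 2 ≤ 16 ^ m := by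
  induction m with
  | zero => simp
  | succ m ih =>
    have h := Nat.succ_mul_centralBinom_succ m
    have h2 : (m + 1) ^ 2 * ((2 * (m + 1) + 1) * (Nat.centralBinom (m + 1)) ^ 2)
        ≤ (m + 1) ^ 2 * 16 ^ (m + 1) := by
      calc (m + 1) ^ 2 * ((2 * (m + 1) + 1) * (Nat.centralBinom (m + 1)) ^ 2)
          = (2 * m + 3) * ((m + 1) * Nat.centralBinom (m + 1)) ^ 2 := by ring
        _ = (4 * (2 * m + 3) * (2 * m + 1)) * ((2 * m + 1) * Nat.centralBinom m ^ 2) := by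
            rw [h]; ring
        _ ≤ (16 * (m + 1) ^ 2) * 16 ^ m := by
            apply Nat.mul_le_mul _ ih
            nlinarith
        _ = _ := by ring
    exact Nat.le_of_mul_le_mul_left h2 (by positivity)

theorem choose_sq_bound (n k : ℕ) : (n + 1) * (n.choose k) ^ 2 ≤ 4 ^ n := by
  have h1 : n.choose k ≤ n.choose (n / 2) := Nat.choose_le_middle k n
  refine le_trans (Nat.mul_le_mul_left _ (Nat.pow_le_pow_left h1 2)) ?_
  rcases Nat.even_or_odd' n with ⟨m, rfl | rfl⟩
  · have : 2 * m / 2 = m := by omega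
    rw [this, ← Nat.centralBinom_eq_two_mul_choose, pow_mul]
    exact centralBinom_sq_bound m
  · have : (2 * m + 1) / 2 = m := by omega
    rw [this]
    have hc : Nat.centralBinom (m + 1) = 2 * (2 * m + 1).choose m := by
      rw [Nat.centralBinom_eq_two_mul_choose, show 2 * (m + 1) = (2 * m + 1) + 1 by ring,
        Nat.choose_succ_succ, Nat.choose_symm_half]; ring
    have := centralBinom_sq_bound (m + 1)
    rw [hc] at this
    have e : (16 : ℕ) ^ (m + 1) = 4 * 4 ^ (2 * m + 1) := by
      rw [pow_succ 4, pow_mul, pow_succ]; norm_num; ring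
    rw [e] at this
    nlinarith [sq_nonneg ((2 * m + 1).choose m)]

theorem hk1_le (n : ℕ) (y : ℤ) : hk1 n y ≤ 1 / Real.sqrt (n + 1) := by
  by_cases h : ∃ k : ℕ, y = 2 * k - n
  · obtain ⟨k, rfl⟩ := h
    rw [(hk1_formula n).1 k]
    have hb : ((n : ℝ) + 1) * (n.choose k : ℝ) ^ 2 ≤ 4 ^ n := by
      exact_mod_cast choose_sq_bound n k
    have h3 : Real.sqrt (n + 1) * (n.choose k : ℝ) ≤ 2 ^ n := by
      refine (sq_le_sq₀ (by positivity) (by positivity)).mp ?_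
      rw [mul_pow, Real.sq_sqrt (by positivity), ← pow_mul, mul_comm n 2, pow_mul]
      norm_num; exact hb
    rw [div_le_div_iff₀ (by positivity) (by positivity)]
    linarith
  · push Not at h
    rw [(hk1_formula n).2 y h]; positivity

/-! ### Averaging over the number of steps in each direction -/

/-- Multinomial average. -/
def mavg (d : ℕ) : ℕ → ((Fin d → ℕ) → ℝ) → ℝ
  | 0 => fun f => f 0
  | t + 1 => fun f => (∑ i, mavg d t (fun n => f (n + Pi.single i 1))) / d

theorem mavg_mono {d : ℕ} (t : ℕ) {f g : (Fin d → ℕ) → ℝ} (h : ∀ n, f n ≤ g n) :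
    mavg d t f ≤ mavg d t g := by
  induction t generalizing f g with
  | zero => exact h 0
  | succ t ih =>
    simp only [mavg]
    gcongr
    exact ih fun n => h _

theorem mavg_add {d : ℕ} (t : ℕ) (f g : (Fin d → ℕ) → ℝ) :
    mavg d t (fun n => f n + g n) = mavg d t f + mavg d t g := by
  induction t generalizing f g with
  | zero => rfl
  | succ t ih =>
    simp only [mavg, ih, Finset.sum_add_distrib, add_div]

theorem mavg_smul {d : ℕ} (t : ℕ) (c : ℝ) (f : (Fin d → ℕ) → ℝ) :
    mavg d t (fun n => c * f n) = c * mavg d t f := by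
  induction t generalizing f with
  | zero => rfl
  | succ t ih =>
    simp only [mavg, ih, ← Finset.mul_sum, mul_div_assoc]

theorem mavg_zero {d : ℕ} (t : ℕ) : mavg d t (fun _ => 0) = 0 := by
  have := mavg_smul (d := d) t 0 (fun _ => 0)
  simpa using this

theorem mavg_sum {d : ℕ} {ι : Type*} (s : Finset ι) (t : ℕ) (f : ι → (Fin d → ℕ) → ℝ) :
    mavg d t (fun n => ∑ i ∈ s, f i n) = ∑ i ∈ s, mavg d t (f i) := by
  induction s using Finset.induction_on with
  | empty => simpa using mavg_zero t
  | insert a s ha ih =>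
    simp only [Finset.sum_insert ha]
    rw [mavg_add, ih]

theorem mavg_const {d : ℕ} (hd : 0 < d) (t : ℕ) (c : ℝ) : mavg d t (fun _ => c) = c := by
  induction t with
  | zero => rfl
  | succ t ih =>
    simp only [mavg, ih]
    have : (d : ℝ) ≠ 0 := by positivity
    simp; field_simp

theorem mavg_half {d : ℕ} (hd : 0 < d) (t : ℕ) (i : Fin d) :
    mavg d t (fun n => (1 / 2 : ℝ) ^ (n i)) = (1 - 1 / (2 * d)) ^ t := by
  induction t with
  | zero => simp [mavg]
  | succ t ih =>
    simp only [mavg]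
    have hd' : (d : ℝ) ≠ 0 := by positivity
    have : ∀ j, mavg d t (fun n => (1 / 2 : ℝ) ^ ((n + Pi.single j 1 : Fin d → ℕ) i))
        = (1 - (if j = i then 1 / 2 else 0)) * (1 - 1 / (2 * d)) ^ t := by
      intro j
      by_cases hj : j = i
      · subst hj
        simp only [Pi.add_apply, Pi.single_eq_same, pow_succ, if_true]
        simp_rw [mul_comm _ (1 / 2 : ℝ)]
        rw [mavg_smul, ih]; ring
      · simp only [Pi.add_apply, if_neg hj]
        rw [Pi.single_eq_of_ne (Ne.symm hj)]
        simp only [add_zero]; rw [ih]; ring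
    simp only [this, ← Finset.sum_mul, Finset.sum_sub_distrib]
    simp
    rw [pow_succ]; field_simp

/-! ### The `d`-dimensional heat kernel -/

/-- The step of the walk corresponding to the direction `a`. -/
def stepv {d : ℕ} (a : Fin d × Bool) : Zd d := Pi.single a.1 (if a.2 then 1 else -1)

/-- `d`-dimensional simple random walk heat kernel. -/
def hk (d : ℕ) : ℕ → Zd d → ℝ
  | 0 => fun y => if y = 0 then 1 else 0
  | t + 1 => fun y => (∑ a : Fin d × Bool, hk d t (y - stepv a)) / (2 * d)

theorem hk_eq (d : ℕ) (t : ℕ) (y : Zd d) :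
    hk d t y = mavg d t (fun n => ∏ i, hk1 (n i) (y i)) := by
  induction t generalizing y with
  | zero =>
    simp only [hk, mavg, Pi.zero_apply, hk1]
    by_cases h : y = 0
    · simp [h]
    · rw [if_neg h]
      obtain ⟨i, hi⟩ := Function.ne_iff.mp h
      rw [Finset.prod_eq_zero (Finset.mem_univ i)]
      simpa using hi
  | succ t ih =>
    simp only [hk, mavg]
    rw [Fintype.sum_prod_type]
    have : ∀ i : Fin d, ∑ b : Bool, hk d t (y - stepv (i, b))
        = 2 * mavg d t (fun n => ∏ j, hk1 ((n + Pi.single i 1 : Fin d → ℕ) j) (y j)) := by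
      intro i
      rw [← mavg_smul]
      simp only [ih]
      rw [← mavg_sum]
      congr 1
      ext n
      simp only [Fintype.sum_bool, stepv]
      rw [← Finset.mul_prod_erase _ _ (Finset.mem_univ i),
        ← Finset.mul_prod_erase _ _ (Finset.mem_univ i),
        ← Finset.mul_prod_erase _ _ (Finset.mem_univ i)]
      have e : ∀ v : ℤ, ∏ j ∈ Finset.univ.erase i, hk1 (n j) ((y - Pi.single i v : Zd d) j)
          = ∏ j ∈ Finset.univ.erase i, hk1 (n j) (y j) := by
        intro v
        refine Finset.prod_congr rfl fun j hj => ?_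
        simp [Pi.single_eq_of_ne (Finset.ne_of_mem_erase hj)]
      have e' : ∏ j ∈ Finset.univ.erase i, hk1 ((n + Pi.single i 1 : Fin d → ℕ) j) (y j)
          = ∏ j ∈ Finset.univ.erase i, hk1 (n j) (y j) := by
        refine Finset.prod_congr rfl fun j hj => ?_
        simp [Pi.single_eq_of_ne (Finset.ne_of_mem_erase hj)]
      rw [e, e, e']
      simp [hk1]; ring
    simp only [this, ← Finset.mul_sum]
    rw [mul_div_mul_left _ _ (by norm_num)]

theorem hk_le (d : ℕ) (hd : 5 ≤ d) (t : ℕ) (y : Zd d) :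
    hk d t y ≤ (1 / Real.sqrt (t / (2 * d) + 1)) ^ 5 + d * (1 - (1 / (2 * d : ℝ)) ^ 2) ^ t := by
  rw [hk_eq]
  have hdpos : (0 : ℝ) < d := by positivity
  set δ : ℝ := 1 / (2 * d) with hδ
  have hδ0 : 0 < δ := by positivity
  have hδ1 : δ ≤ 1 := by
    rw [hδ, div_le_one (by positivity)]
    have : (5 : ℝ) ≤ d := by exact_mod_cast hd
    linarith
  have hpt : ∀ n : Fin d → ℕ, ∏ i, hk1 (n i) (y i) ≤
      (1 / Real.sqrt (t / (2 * d) + 1)) ^ 5 + ∑ i, (1 + δ) ^ t * (1 / 2 : ℝ) ^ (n i) := by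
    intro n
    have hb1 : ∀ i, hk1 (n i) (y i) ≤ 1 := fun i => (hk1_le _ _).trans (by
      rw [div_le_one (by positivity)]
      exact Real.one_le_sqrt.mpr (by linarith [Nat.cast_nonneg (α := ℝ) (n i)]))
    by_cases hn : ∀ i, t / (2 * d) ≤ (n i : ℝ)
    · have : ∏ i, hk1 (n i) (y i) ≤ (1 / Real.sqrt (t / (2 * d) + 1)) ^ d := by
        calc _ ≤ ∏ i : Fin d, (1 / Real.sqrt (t / (2 * d) + 1)) := by
              refine Finset.prod_le_prod (fun i _ => hk1_nonneg _ _) fun i _ => ?_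
              refine (hk1_le _ _).trans ?_
              have := hn i
              gcongr
          _ = _ := by simp
      refine this.trans ?_
      have h5 : (1 / Real.sqrt (t / (2 * d) + 1)) ^ d ≤ (1 / Real.sqrt (t / (2 * d) + 1)) ^ 5 := by
        apply pow_le_pow_of_le_one (by positivity) _ hd
        rw [div_le_one (by positivity)]
        exact Real.one_le_sqrt.mpr (by simp; positivity)
      have : 0 ≤ ∑ i, (1 + δ) ^ t * (1 / 2 : ℝ) ^ (n i) := by positivity
      linarith
    · push Not at hn
      obtain ⟨i, hi⟩ := hn
      have h1 : ∏ i, hk1 (n i) (y i) ≤ 1 :=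
        Finset.prod_le_one (fun i _ => hk1_nonneg _ _) fun i _ => hb1 i
      have h2 : (1 : ℝ) ≤ (1 + δ) ^ t * (1 / 2 : ℝ) ^ (n i) := by
        have h3 : (2 : ℝ) ^ (n i) ≤ (1 + δ) ^ t := by
          have hx : (2 : ℝ) ^ δ ≤ 1 + δ := by
            have := rpow_one_add_le_one_add_mul_self (s := 1) (by norm_num) hδ0.le hδ1
            norm_num at this; linarith
          calc (2 : ℝ) ^ (n i) = (2 : ℝ) ^ ((n i : ℕ) : ℝ) := by rw [Real.rpow_natCast]
            _ ≤ (2 : ℝ) ^ (δ * t) := by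
                apply Real.rpow_le_rpow_of_exponent_le (by norm_num)
                rw [hδ]; rw [div_mul_eq_mul_div, one_mul]; exact hi.le
            _ = ((2 : ℝ) ^ δ) ^ t := by rw [Real.rpow_mul (by norm_num), Real.rpow_natCast]
            _ ≤ _ := by gcongr
        calc (1 : ℝ) = 2 ^ (n i) * (1 / 2) ^ (n i) := by rw [← mul_pow]; norm_num
          _ ≤ _ := by gcongr
      have h4 : (1 + δ) ^ t * (1 / 2 : ℝ) ^ (n i) ≤ ∑ i, (1 + δ) ^ t * (1 / 2 : ℝ) ^ (n i) :=
        Finset.single_le_sum (f := fun i => (1 + δ) ^ t * (1 / 2 : ℝ) ^ (n i))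
          (fun j _ => by positivity) (Finset.mem_univ i)
      have : 0 ≤ (1 / Real.sqrt (t / (2 * d) + 1)) ^ 5 := by positivity
      linarith
  refine (mavg_mono t hpt).trans ?_
  rw [mavg_add, mavg_const (by omega), mavg_sum]
  simp only [mavg_smul]
  simp only [mavg_half (show 0 < d by omega)]
  rw [Finset.sum_const, Finset.card_univ, Fintype.card_fin, nsmul_eq_mul, ← mul_pow]
  rw [← hδ]
  apply le_of_eq
  ring

/-! ### The walk driven by i.i.d. steps -/

/-- Uniform measure on the set of directions. -/
def unifStep (d : ℕ) : Measure (Fin d × Bool) := (((2 * d : ℕ) : ℝ≥0∞))⁻¹ • Measure.count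

theorem unifStep_singleton (d : ℕ) (a : Fin d × Bool) :
    unifStep d {a} = (((2 * d : ℕ) : ℝ≥0∞))⁻¹ := by
  simp [unifStep]

theorem unifStep_prob (d : ℕ) (hd : 0 < d) : IsProbabilityMeasure (unifStep d) := by
  constructor
  rw [unifStep, Measure.smul_apply, Measure.count_univ]
  simp only [ENat.card_eq_coe_fintype_card, Fintype.card_prod, Fintype.card_fin, Fintype.card_bool,
    smul_eq_mul]
  rw [mul_comm d 2]
  apply ENNReal.inv_mul_cancel
  · simp; omega
  · exact ENNReal.natCast_ne_top _

/-- Law of the i.i.d. steps. -/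
def stepLaw (d : ℕ) : Measure (ℕ → Fin d × Bool) := Measure.infinitePi (fun _ => unifStep d)

/-- The walk with given steps. -/
def walk {d : ℕ} (x : Zd d) (s : ℕ → Fin d × Bool) (t : ℕ) : Zd d :=
  x + ∑ j ∈ Finset.range t, stepv (s j)

theorem walk_succ {d : ℕ} (x : Zd d) (s : ℕ → Fin d × Bool) (t : ℕ) :
    walk x s (t + 1) = walk x s t + stepv (s t) := by
  simp [walk, Finset.sum_range_succ, add_assoc]

theorem walk_zero {d : ℕ} (x : Zd d) (s : ℕ → Fin d × Bool) : walk x s 0 = x := by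
  simp [walk]

theorem measurable_walk {d : ℕ} (x : Zd d) : Measurable (walk x) := by
  refine measurable_pi_lambda _ fun t => ?_
  unfold walk
  refine measurable_const.add ?_
  refine Finset.measurable_fun_sum _ fun j _ => ?_
  exact (Measurable.of_discrete (f := stepv)).comp (measurable_pi_apply j)

theorem stepv_injective {d : ℕ} : Function.Injective (stepv (d := d)) := by
  rintro ⟨i, b⟩ ⟨i', b'⟩ h
  have hi : i = i' := by
    by_contra hne
    have := congrFun h i
    simp only [stepv, Pi.single_eq_same, Pi.single_eq_of_ne hne] at this
    cases b <;> simp at this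
  subst hi
  have := congrFun h i
  simp only [stepv, Pi.single_eq_same] at this
  cases b <;> cases b' <;> simp_all

theorem isNN_iff {d : ℕ} (x y : Zd d) : IsNN x y ↔ ∃ a, y = x + stepv a := by
  constructor
  · intro h
    unfold IsNN at h
    have hex : ∃ i, (x i - y i).natAbs ≠ 0 := by
      by_contra hc
      push Not at hc
      simp [hc] at h
    obtain ⟨i, hi⟩ := hex
    rw [← Finset.add_sum_erase _ _ (Finset.mem_univ i)] at h
    have h1 : (x i - y i).natAbs = 1 := by omega
    have h0 : ∑ j ∈ Finset.univ.erase i, (x j - y j).natAbs = 0 := by omega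
    have h0' : ∀ j, j ≠ i → y j = x j := by
      intro j hj
      have := (Finset.sum_eq_zero_iff.mp h0) j (by simp [hj])
      omega
    refine ⟨(i, decide (y i = x i + 1)), ?_⟩
    ext j
    by_cases hj : j = i
    · subst hj
      simp only [stepv, Pi.add_apply, Pi.single_eq_same]
      by_cases hh : y j = x j + 1
      · simp [hh]
      · simp [hh]; omega
    · simp [stepv, Pi.single_eq_of_ne hj, h0' j hj]
  · rintro ⟨⟨i, b⟩, rfl⟩
    unfold IsNN
    rw [← Finset.add_sum_erase _ _ (Finset.mem_univ i), Finset.sum_eq_zero]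
    · cases b <;> simp [stepv]
    · intro j hj
      simp [stepv, Pi.single_eq_of_ne (Finset.ne_of_mem_erase hj)]

theorem stepLaw_prob (d : ℕ) (hd : 0 < d) : IsProbabilityMeasure (stepLaw d) := by
  have := unifStep_prob d hd
  unfold stepLaw; infer_instance

theorem walk_cylinder {d : ℕ} (hd : 0 < d) (x : Zd d) (T : ℕ) (w : ℕ → Zd d) :
    stepLaw d {s | ∀ t ≤ T, walk x s t = w t} =
      if w 0 = x ∧ ∀ t < T, IsNN (w t) (w (t + 1)) then
          (((2 * d : ℕ) : ℝ≥0∞))⁻¹ ^ T else 0 := by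
  have := unifStep_prob d hd
  split_ifs with h
  · obtain ⟨h0, h1⟩ := h
    have h2 : ∀ t, ∃ a : Fin d × Bool, t < T → w (t + 1) = w t + stepv a := by
      intro t
      by_cases ht : t < T
      · obtain ⟨a, ha⟩ := (isNN_iff _ _).mp (h1 t ht)
        exact ⟨a, fun _ => ha⟩
      · exact ⟨(⟨0, hd⟩, true), fun h => absurd h ht⟩
    choose a ha using h2
    have hset : {s : ℕ → Fin d × Bool | ∀ t ≤ T, walk x s t = w t}
        = Set.pi (Finset.range T : Finset ℕ) (fun t => {a t}) := by
      ext s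
      simp only [Set.mem_setOf_eq, Set.mem_pi, Finset.coe_range, Set.mem_Iio,
        Set.mem_singleton_iff]
      constructor
      · intro hs t ht
        have e1 := hs (t + 1) (by omega)
        rw [walk_succ, hs t (by omega), ha t ht] at e1
        exact stepv_injective (add_left_cancel e1)
      · intro hs t
        induction t with
        | zero => intro _; rw [walk_zero, h0]
        | succ t ih =>
          intro ht
          rw [walk_succ, ih (by omega), hs t (by omega), ha t (by omega)]
    rw [hset, stepLaw, Measure.infinitePi_pi _ (fun _ _ => measurableSet_singleton _)]
    simp only [unifStep_singleton]
    simp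
  · convert measure_empty (μ := stepLaw d)
    rw [Set.eq_empty_iff_forall_notMem]
    intro s hs
    apply h
    refine ⟨?_, fun t ht => ?_⟩
    · rw [← hs 0 (by omega), walk_zero]
    · rw [isNN_iff]
      refine ⟨s t, ?_⟩
      rw [← hs t (by omega), ← hs (t + 1) (by omega), walk_succ]

/-- Path cylinders. -/
def cyl {d : ℕ} (T : ℕ) (w : ℕ → Zd d) : Set (ℕ → Zd d) := {ω | ∀ t ≤ T, ω t = w t}

theorem measurableSet_cyl {d : ℕ} (T : ℕ) (w : ℕ → Zd d) : MeasurableSet (cyl T w) := by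
  have : cyl T w = ⋂ t, ⋂ (_ : t ≤ T), (fun ω : ℕ → Zd d => ω t) ⁻¹' {w t} := by
    ext ω; simp [cyl]
  rw [this]
  exact MeasurableSet.iInter fun t => MeasurableSet.iInter fun _ =>
    measurable_pi_apply t (measurableSet_singleton _)

theorem srw_unique {d : ℕ} (hd : 0 < d) (x : Zd d) (P : Measure (ℕ → Zd d)) (hP : IsSRW d x P) :
    P = (stepLaw d).map (walk x) := by
  have := stepLaw_prob d hd
  have hprob := hP.1
  have := Measure.isProbabilityMeasure_map (μ := stepLaw d) (measurable_walk x).aemeasurable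
  let C : Set (Set (ℕ → Zd d)) := {A | ∃ T w, A = cyl T w}
  refine MeasureTheory.ext_of_generate_finite C ?_ ?_ ?_ ?_
  · apply le_antisymm
    · rw [MeasurableSpace.pi, iSup_le_iff]
      intro t
      rw [← measurable_iff_comap_le]
      refine @measurable_to_countable' _ _ _ _ (MeasurableSpace.generateFrom C) _ fun y => ?_
      have hset : (fun ω : ℕ → Zd d => ω t) ⁻¹' {y} =
          ⋃ v : Fin t → Zd d, cyl t (fun j => if h : j < t then v ⟨j, h⟩ else y) := by
        ext ω
        simp only [Set.mem_preimage, Set.mem_singleton_iff, Set.mem_iUnion, cyl, Set.mem_setOf_eq]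
        constructor
        · intro h
          refine ⟨fun j => ω j, fun j hj => ?_⟩
          split_ifs with hjt
          · rfl
          · have : j = t := by omega
            rw [this, h]
        · rintro ⟨v, hv⟩
          have := hv t le_rfl
          simpa using this
      rw [hset]
      exact @MeasurableSet.iUnion _ _ (MeasurableSpace.generateFrom C) _ _ fun v =>
        MeasurableSpace.measurableSet_generateFrom ⟨_, _, rfl⟩
    · apply MeasurableSpace.generateFrom_le
      rintro _ ⟨T, w, rfl⟩
      exact measurableSet_cyl T w
  · have key : ∀ (T T' : ℕ) (w w' : ℕ → Zd d), T ≤ T' → (cyl T w ∩ cyl T' w').Nonempty →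
        cyl T w ∩ cyl T' w' = cyl T' w' := by
      rintro T T' w w' hT ⟨ω, h1, h2⟩
      apply Set.inter_eq_right.mpr
      intro ω' hω' t ht
      rw [hω' t (ht.trans hT), ← h2 t (ht.trans hT), h1 t ht]
    rintro _ ⟨T, w, rfl⟩ _ ⟨T', w', rfl⟩ hne
    rcases le_total T T' with h | h
    · exact ⟨T', w', key _ _ _ _ h hne⟩
    · rw [Set.inter_comm] at hne ⊢
      exact ⟨T, w, key _ _ _ _ h hne⟩
  · rintro _ ⟨T, w, rfl⟩
    rw [Measure.map_apply (measurable_walk x) (measurableSet_cyl T w)]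
    exact (hP.2 T w).trans (walk_cylinder hd x T w).symm
  · simp

theorem walk_heat {d : ℕ} (hd : 0 < d) (x : Zd d) (t : ℕ) (y : Zd d) :
    stepLaw d {s | walk x s t = y} ≤ ENNReal.ofReal (hk d t (y - x)) := by
  have := unifStep_prob d hd
  have := stepLaw_prob d hd
  induction t generalizing y with
  | zero =>
    simp only [walk_zero, hk]
    by_cases h : x = y
    · subst h; simp
    · simp [h]
  | succ t ih =>
    have hind : iIndepFun (fun (j : ℕ) (s : ℕ → Fin d × Bool) => stepv (s j)) (stepLaw d) :=
      iIndepFun_infinitePi (X := fun _ => stepv) (fun _ => Measurable.of_discrete)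
    have hmeas : ∀ j : ℕ, Measurable (fun s : ℕ → Fin d × Bool => stepv (s j)) := fun j =>
      (Measurable.of_discrete (f := stepv)).comp (measurable_pi_apply j)
    have hi2 := hind.indepFun_finsetSum_of_notMem hmeas (s := Finset.range t) (i := t) (by simp)
    have hsub : {s : ℕ → Fin d × Bool | walk x s (t + 1) = y} ⊆
        ⋃ a : Fin d × Bool, ((∑ j ∈ Finset.range t, fun s : ℕ → Fin d × Bool => stepv (s j)) ⁻¹'
          {y - stepv a - x} ∩ (fun s : ℕ → Fin d × Bool => stepv (s t)) ⁻¹' {stepv a}) := by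
      intro s hs
      rw [Set.mem_setOf_eq, walk_succ] at hs
      rw [Set.mem_iUnion]
      refine ⟨s t, ?_, rfl⟩
      simp only [Set.mem_preimage, Finset.sum_apply, Set.mem_singleton_iff]
      rw [← hs, walk]; abel
    have hterm : ∀ a : Fin d × Bool, stepLaw d
        ((∑ j ∈ Finset.range t, fun s : ℕ → Fin d × Bool => stepv (s j)) ⁻¹'
          {y - stepv a - x} ∩ (fun s : ℕ → Fin d × Bool => stepv (s t)) ⁻¹' {stepv a})
        ≤ ENNReal.ofReal (hk d t (y - stepv a - x)) * (((2 * d : ℕ) : ℝ≥0∞))⁻¹ := by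
      intro a
      rw [hi2.measure_inter_preimage_eq_mul _ _ (measurableSet_singleton _)
        (measurableSet_singleton _)]
      gcongr
      · refine le_trans (measure_mono ?_) (ih (y - stepv a))
        intro s hs
        simp only [Set.mem_preimage, Finset.sum_apply, Set.mem_singleton_iff] at hs
        simp only [Set.mem_setOf_eq, walk, hs]; abel
      · have : (fun s : ℕ → Fin d × Bool => stepv (s t)) ⁻¹' {stepv a}
            = Set.pi (({t} : Finset ℕ) : Set ℕ) (fun _ => {a}) := by
          ext s; simp [stepv_injective.eq_iff]
        rw [this, stepLaw, Measure.infinitePi_pi _ (fun _ _ => measurableSet_singleton _)]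
        simp [unifStep_singleton]
    refine (measure_mono hsub).trans ((measure_iUnion_fintype_le _ _).trans ?_)
    refine (Finset.sum_le_sum fun a _ => hterm a).trans ?_
    have hknn : ∀ t y, 0 ≤ hk d t y := by
      intro t
      induction t with
      | zero => intro y; simp only [hk]; split_ifs <;> norm_num
      | succ t ih => intro y; simp only [hk]; exact div_nonneg (Finset.sum_nonneg fun _ _ => ih _) (by positivity)
    rw [← Finset.sum_mul, ← ENNReal.ofReal_sum_of_nonneg (fun _ _ => hknn _ _)]
    simp only [hk]
    rw [ENNReal.ofReal_div_of_pos (by positivity), div_eq_mul_inv]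
    apply le_of_eq
    congr 1
    · congr 1
      refine Finset.sum_congr rfl fun a _ => ?_
      congr 1; abel
    · congr 1
      rw [show (2 * (d : ℝ)) = ((2 * d : ℕ) : ℝ) by push_cast; ring, ENNReal.ofReal_natCast]

theorem step_integral {d : ℕ} (hd : 0 < d) (i : Fin d) (σ : ℝ) (j : ℕ) :
    ∫ s, σ * ((stepv (s j) i : ℤ) : ℝ) ∂(stepLaw d) = 0 := by
  have := unifStep_prob d hd
  have h := integral_map (μ := stepLaw d) (φ := fun s : ℕ → Fin d × Bool => s j)
    (f := fun a => σ * ((stepv a i : ℤ) : ℝ)) (measurable_pi_apply j).aemeasurable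
    (Measurable.of_discrete.aestronglyMeasurable)
  rw [← h, stepLaw, Measure.infinitePi_map_eval, integral_const_mul]
  have : ∫ a, ((stepv a i : ℤ) : ℝ) ∂(unifStep d) = 0 := by
    rw [unifStep, integral_smul_measure, integral_countable' (by
      exact Integrable.of_finite), tsum_fintype, Fintype.sum_prod_type]
    rw [Finset.sum_eq_zero, smul_zero]
    intro k _
    by_cases hk : i = k
    · subst hk; simp [stepv, Measure.real]
    · simp [stepv, Pi.single_eq_of_ne hk]
  rw [this, mul_zero]

theorem step_hoeffding {d : ℕ} (hd : 0 < d) (i : Fin d) (σ : ℝ) (hσ : |σ| = 1) (n : ℕ) (ε : ℝ)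
    (hε : 0 ≤ ε) :
    stepLaw d {s | ε ≤ ∑ j ∈ Finset.range n, σ * ((stepv (s j) i : ℤ) : ℝ)} ≤
      ENNReal.ofReal (Real.exp (-ε ^ 2 / (2 * n))) := by
  have := unifStep_prob d hd
  have := stepLaw_prob d hd
  have hind : iIndepFun (fun (j : ℕ) (s : ℕ → Fin d × Bool) => σ * ((stepv (s j) i : ℤ) : ℝ))
      (stepLaw d) :=
    iIndepFun_infinitePi (X := fun _ a => σ * ((stepv a i : ℤ) : ℝ))
      (fun _ => Measurable.of_discrete)
  have hsub : ∀ j, HasSubgaussianMGF (fun s : ℕ → Fin d × Bool => σ * ((stepv (s j) i : ℤ) : ℝ))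
      ((‖(1 : ℝ) - (-1)‖₊ / 2) ^ 2) (stepLaw d) := by
    intro j
    refine hasSubgaussianMGF_of_mem_Icc_of_integral_eq_zero ?_ ?_ (step_integral hd i σ j)
    · exact ((Measurable.of_discrete (f := fun a => σ * ((stepv a i : ℤ) : ℝ))).comp
        (measurable_pi_apply j)).aemeasurable
    · refine Eventually.of_forall fun s => ?_
      rw [Set.mem_Icc, ← abs_le, abs_mul, hσ, one_mul]
      rcases s j with ⟨k, b⟩
      by_cases hk : i = k
      · subst hk; cases b <;> simp [stepv]
      · simp [stepv, Pi.single_eq_of_ne hk]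
  have h := HasSubgaussianMGF.measure_sum_range_ge_le_of_iIndepFun hind (n := n)
    (fun j _ => hsub j) hε
  have hc : (((‖(1 : ℝ) - (-1)‖₊ / 2) ^ 2 : ℝ≥0) : ℝ) = 1 := by
    push_cast; norm_num
  rw [hc, mul_one] at h
  rw [← ENNReal.ofReal_toReal (measure_ne_top (stepLaw d) _)]
  exact ENNReal.ofReal_le_ofReal h

/-- The walk moves far away before time `s`. -/
def farSet {d : ℕ} (x : Zd d) (m : ℕ) (r : ℝ) : Set (ℕ → Fin d × Bool) :=
  {s | ∃ j ≤ m, ∃ i, r < |((walk x s j i - x i : ℤ) : ℝ)|}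

theorem farSet_le {d : ℕ} (hd : 0 < d) (x : Zd d) (m : ℕ) (r : ℝ) (hr : 0 ≤ r) :
    stepLaw d (farSet x m r) ≤
      ENNReal.ofReal (2 * d * m * Real.exp (-r ^ 2 / (2 * m))) := by
  let B : ℕ × Fin d × Bool → Set (ℕ → Fin d × Bool) := fun q =>
    {s | r ≤ ∑ j ∈ Finset.range q.1, (if q.2.2 then (1 : ℝ) else -1) * ((stepv (s j) q.2.1 : ℤ) : ℝ)}
  have hsub : farSet x m r ⊆ ⋃ q ∈ (Finset.Icc 1 m ×ˢ (Finset.univ : Finset (Fin d × Bool))), B q := by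
    rintro s ⟨j, hj, i, hji⟩
    have hj0 : 1 ≤ j := by
      by_contra hc
      have : j = 0 := by omega
      subst this
      simp [walk_zero] at hji; linarith
    have e : ((walk x s j i - x i : ℤ) : ℝ) = ∑ k ∈ Finset.range j, ((stepv (s k) i : ℤ) : ℝ) := by
      simp [walk]
    rw [e] at hji
    simp only [Set.mem_iUnion]
    rcases lt_abs.mp hji with h | h
    · refine ⟨(j, i, true), by simp; omega, ?_⟩
      simp only [B, Set.mem_setOf_eq, if_true, one_mul]; exact h.le
    · refine ⟨(j, i, false), by simp; omega, ?_⟩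
      simp only [B, Set.mem_setOf_eq]
      rw [← Finset.mul_sum]; simp; linarith
  refine (measure_mono hsub).trans ((measure_biUnion_finset_le _ _).trans ?_)
  have hB : ∀ q ∈ (Finset.Icc 1 m ×ˢ (Finset.univ : Finset (Fin d × Bool))),
      stepLaw d (B q) ≤ ENNReal.ofReal (Real.exp (-r ^ 2 / (2 * m))) := by
    rintro ⟨j, i, b⟩ hq
    simp only [Finset.mem_product, Finset.mem_Icc, Finset.mem_univ, and_true] at hq
    refine (step_hoeffding hd i (if b then 1 else -1) (by cases b <;> simp) j r hr).trans ?_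
    apply ENNReal.ofReal_le_ofReal
    apply Real.exp_le_exp.mpr
    rw [neg_div, neg_div, neg_le_neg_iff]
    have : (0 : ℝ) < j := by exact_mod_cast hq.1
    have : (j : ℝ) ≤ m := by exact_mod_cast hq.2
    gcongr
  refine (Finset.sum_le_sum hB).trans ?_
  rw [Finset.sum_const, nsmul_eq_mul, ← ENNReal.ofReal_natCast, ← ENNReal.ofReal_mul (by positivity)]
  apply ENNReal.ofReal_le_ofReal
  simp only [Finset.card_product, Nat.card_Icc, Finset.card_univ, Fintype.card_prod,
    Fintype.card_fin, Fintype.card_bool]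
  push_cast
  apply le_of_eq
  simp
  ring

/-! ### Splicing and the coupling -/

/-- Use `u` before time `m` and `v` afterwards. -/
def splice {d : ℕ} (m : ℕ) (q : (ℕ → Fin d × Bool) × (ℕ → Fin d × Bool)) : ℕ → Fin d × Bool :=
  fun j => if j < m then q.1 j else q.2 j

theorem measurable_splice {d : ℕ} (m : ℕ) : Measurable (splice (d := d) m) := by
  refine measurable_pi_lambda _ fun j => ?_
  unfold splice
  split_ifs
  · exact (measurable_pi_apply j).comp measurable_fst
  · exact (measurable_pi_apply j).comp measurable_snd

theorem splice_law {d : ℕ} (hd : 0 < d) (m : ℕ) :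
    ((stepLaw d).prod (stepLaw d)).map (splice m) = stepLaw d := by
  have := unifStep_prob d hd
  have := stepLaw_prob d hd
  refine Measure.eq_infinitePi _ fun I t ht => ?_
  rw [Measure.map_apply (measurable_splice m) (MeasurableSet.pi I.countable_toSet fun i _ => ht i)]
  have hset : splice m ⁻¹' (Set.pi (I : Set ℕ) t) =
      (Set.pi ((I.filter (fun j => j < m) : Finset ℕ) : Set ℕ) t) ×ˢ
      (Set.pi ((I.filter (fun j => ¬ j < m) : Finset ℕ) : Set ℕ) t) := by
    ext q
    simp only [Set.mem_preimage, Set.mem_pi, Set.mem_prod, Finset.mem_coe, Finset.mem_filter, splice]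
    constructor
    · intro h
      refine ⟨fun j hj => ?_, fun j hj => ?_⟩
      · have := h j hj.1; rwa [if_pos hj.2] at this
      · have := h j hj.1; rwa [if_neg hj.2] at this
    · rintro ⟨h1, h2⟩ j hj
      split_ifs with hjm
      · exact h1 j ⟨hj, hjm⟩
      · exact h2 j ⟨hj, hjm⟩
  rw [hset, Measure.prod_prod, stepLaw, Measure.infinitePi_pi _ (fun i _ => ht i),
    Measure.infinitePi_pi _ (fun i _ => ht i), Finset.prod_filter_mul_prod_filter_not]

theorem walk_splice_le {d : ℕ} (x : Zd d) (m : ℕ) (q : (ℕ → Fin d × Bool) × (ℕ → Fin d × Bool))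
    (t : ℕ) (ht : t ≤ m) : walk x (splice m q) t = walk x q.1 t := by
  unfold walk
  congr 1
  refine Finset.sum_congr rfl fun j hj => ?_
  rw [Finset.mem_range] at hj
  simp only [splice]; rw [if_pos (by omega)]

theorem walk_splice_ge {d : ℕ} (x : Zd d) (m : ℕ) (q : (ℕ → Fin d × Bool) × (ℕ → Fin d × Bool))
    (j : ℕ) : walk x (splice m q) (m + j) - walk x q.2 (m + j) = walk x q.1 m - walk x q.2 m := by
  induction j with
  | zero => rw [add_zero, walk_splice_le x m q m le_rfl]
  | succ j ih =>
    rw [← add_assoc, walk_succ, walk_succ]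
    have : splice m q (m + j) = q.2 (m + j) := by simp [splice]
    rw [this, ← ih]; abel

theorem measurableSet_noReturn {d : ℕ} (A : Set (Zd d)) : MeasurableSet (NoReturn A) := by
  have : NoReturn A = ⋂ t : ℕ, ⋂ (_ : 0 < t), (fun ω : ℕ → Zd d => ω t) ⁻¹' Aᶜ := by
    ext ω; simp [NoReturn]
  rw [this]
  exact MeasurableSet.iInter fun t => MeasurableSet.iInter fun _ =>
    measurable_pi_apply t (Set.to_countable _).measurableSet

/-- No return up to the integer time `m`. -/
def noRet {d : ℕ} (A : Set (Zd d)) (m : ℕ) : Set (ℕ → Zd d) := {ω | ∀ t, 0 < t → t ≤ m → ω t ∉ A}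

theorem measurableSet_noRet {d : ℕ} (A : Set (Zd d)) (m : ℕ) : MeasurableSet (noRet A m) := by
  have : noRet A m = ⋂ t : ℕ, ⋂ (_ : 0 < t), ⋂ (_ : t ≤ m), (fun ω : ℕ → Zd d => ω t) ⁻¹' Aᶜ := by
    ext ω; simp [noRet]
  rw [this]
  exact MeasurableSet.iInter fun t => MeasurableSet.iInter fun _ => MeasurableSet.iInter fun _ =>
    measurable_pi_apply t (Set.to_countable _).measurableSet

/-- The good coupling event. -/
def goodEv {d : ℕ} (l : ℝ) (t : ℕ) : Set ((ℕ → Zd d) × (ℕ → Zd d)) :=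
  {p | (∀ j : ℕ, ∀ i, |((p.1 j i - p.2 j i : ℤ) : ℝ)| ≤ l) ∧
              ∀ j : ℕ, p.1 (t + j) - p.1 t = p.2 (t + j) - p.2 t}

theorem measurableSet_goodEv {d : ℕ} (l : ℝ) (t : ℕ) : MeasurableSet (goodEv (d := d) l t) := by
  have m1 : ∀ j : ℕ, Measurable (fun p : (ℕ → Zd d) × (ℕ → Zd d) => p.1 j) := fun j =>
    (measurable_pi_apply j).comp measurable_fst
  have m2 : ∀ j : ℕ, Measurable (fun p : (ℕ → Zd d) × (ℕ → Zd d) => p.2 j) := fun j =>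
    (measurable_pi_apply j).comp measurable_snd
  have : goodEv (d := d) l t = (⋂ j : ℕ, ⋂ i : Fin d,
      (fun p : (ℕ → Zd d) × (ℕ → Zd d) => p.1 j - p.2 j) ⁻¹' {z | |((z i : ℤ) : ℝ)| ≤ l}) ∩
      ⋂ j : ℕ, {p | p.1 (t + j) - p.1 t = p.2 (t + j) - p.2 t} := by
    ext p; simp [goodEv]
  rw [this]
  refine MeasurableSet.inter (MeasurableSet.iInter fun j => MeasurableSet.iInter fun i => ?_)
    (MeasurableSet.iInter fun j => ?_)
  · exact ((m1 j).sub (m2 j)) (Set.to_countable _).measurableSet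
  · exact measurableSet_eq_fun ((m1 _).sub (m1 _)) ((m2 _).sub (m2 _))

/-- Abstract gluing: from a coupling of `ν` and `μ` build a coupling of `ν₁` and `μ` when
`ν` restricted to `B` is a multiple of `ν₁`. -/
theorem glue {α : Type*} [MeasurableSpace α] (Pi0 : Measure (α × α)) [IsFiniteMeasure Pi0]
    (ν₁ μ : Measure α) [IsProbabilityMeasure ν₁] (B : Set α) (hB : MeasurableSet B)
    (c : ℝ≥0∞) (h1 : (Pi0.map Prod.fst).restrict B = c • ν₁) (h2 : Pi0.map Prod.snd = μ)
    (hp : Pi0 Set.univ = 1) (E : Set (α × α)) :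
    ∃ Q : Measure (α × α), Q.map Prod.fst = ν₁ ∧ Q.map Prod.snd = μ ∧
      1 ≤ Q E + (Pi0 Eᶜ + Pi0.map Prod.fst Bᶜ) := by
  set D : Set (α × α) := Prod.fst ⁻¹' B with hD
  have hDm : MeasurableSet D := measurable_fst hB
  let Q := Pi0.restrict D + ν₁.prod ((Pi0.restrict Dᶜ).map Prod.snd)
  have hc : c = Pi0 D := by
    have := congrArg (fun m => m Set.univ) h1
    simp only [Measure.restrict_apply_univ, Measure.smul_apply, measure_univ, smul_eq_mul,
      mul_one] at this
    rw [Measure.map_apply measurable_fst hB] at this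
    exact this.symm
  have hfst : Q.map Prod.fst = ν₁ := by
    simp only [Q]
    rw [Measure.map_add _ _ measurable_fst, Measure.map_fst_prod,
      ← Measure.restrict_map measurable_fst hB, h1,
      Measure.map_apply measurable_snd MeasurableSet.univ, Set.preimage_univ,
      Measure.restrict_apply_univ, ← add_smul, hc, measure_add_measure_compl hDm, hp, one_smul]
  have hsnd : Q.map Prod.snd = μ := by
    simp only [Q]
    rw [Measure.map_add _ _ measurable_snd, Measure.map_snd_prod, measure_univ, one_smul,
      ← Measure.map_add _ _ measurable_snd, Measure.restrict_add_restrict_compl hDm, h2]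
  refine ⟨Q, hfst, hsnd, ?_⟩
  have hQ1 : Q Set.univ = 1 := by
    have : Q.map Prod.fst Set.univ = 1 := by rw [hfst]; exact measure_univ
    rwa [Measure.map_apply measurable_fst MeasurableSet.univ, Set.preimage_univ] at this
  have hQE : Q Eᶜ ≤ Pi0 Eᶜ + Pi0.map Prod.fst Bᶜ := by
    simp only [Q]
    rw [Measure.add_apply]
    refine add_le_add (Measure.restrict_apply_le _ _) ?_
    refine (measure_mono (Set.subset_univ _)).trans ?_
    rw [Measure.prod_apply MeasurableSet.univ]
    simp only [Set.preimage_univ]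
    rw [lintegral_const, measure_univ (μ := ν₁), mul_one,
      Measure.map_apply measurable_snd MeasurableSet.univ, Set.preimage_univ,
      Measure.restrict_apply_univ, Measure.map_apply measurable_fst hB.compl]
    rfl
  calc 1 = Q Set.univ := hQ1.symm
    _ ≤ Q E + Q Eᶜ := by rw [← Set.union_compl_self E]; exact measure_union_le _ _
    _ ≤ _ := by gcongr

theorem core_coupling {d : ℕ} (hd : 0 < d) (x : Zd d) (P : Measure (ℕ → Zd d)) (hP : IsSRW d x P)
    (A : Set (Zd d)) (m t : ℕ) (hmt : m ≤ t) (l : ℝ) (hl : 0 ≤ l) (hpos : P (NoReturn A) ≠ 0) :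
    ∃ Q : Measure ((ℕ → Zd d) × (ℕ → Zd d)),
      Q.map Prod.fst = ProbabilityTheory.cond P (NoReturn A) ∧ Q.map Prod.snd = P ∧
      1 ≤ Q (goodEv l t) + ((stepLaw d (farSet x m (l / 2)) / P (NoReturn A)
        + stepLaw d (farSet x m (l / 2))) + P (noRet A m \ NoReturn A) / P (noRet A m)) := by
  have := unifStep_prob d hd
  have := stepLaw_prob d hd
  have hPprob := hP.1
  have hPeq := srw_unique hd x P hP
  set μ := stepLaw d with hμ
  set B := NoReturn A with hBdef
  set Bs := noRet A m with hBs
  have hBm : MeasurableSet B := measurableSet_noReturn A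
  have hBsm : MeasurableSet Bs := measurableSet_noRet A m
  have hsub : B ⊆ Bs := fun ω hω t ht _ => hω t ht
  have hBs0 : P Bs ≠ 0 := fun h => hpos (measure_mono_null hsub h)
  have hwm := measurable_walk x
  set G : Set (ℕ → Fin d × Bool) := walk x ⁻¹' Bs with hG
  have hGm : MeasurableSet G := hwm hBsm
  have hPBs : P Bs = μ G := by rw [hPeq, Measure.map_apply hwm hBsm]
  have hG0 : μ G ≠ 0 := hPBs ▸ hBs0
  have hcp : IsProbabilityMeasure (ProbabilityTheory.cond μ G) := cond_isProbabilityMeasure hG0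
  have hnu1 : IsProbabilityMeasure (ProbabilityTheory.cond P B) := cond_isProbabilityMeasure hpos
  let Φ : (ℕ → Fin d × Bool) × (ℕ → Fin d × Bool) → (ℕ → Zd d) × (ℕ → Zd d) :=
    fun q => (walk x (splice m q), walk x q.2)
  have hΦm : Measurable Φ :=
    (hwm.comp (measurable_splice m)).prodMk (hwm.comp measurable_snd)
  let base := (ProbabilityTheory.cond μ G).prod μ
  let Pi0 := base.map Φ
  have hPiprob : IsProbabilityMeasure Pi0 := Measure.isProbabilityMeasure_map hΦm.aemeasurable
  have hmemG : ∀ q : (ℕ → Fin d × Bool) × (ℕ → Fin d × Bool), splice m q ∈ G ↔ q.1 ∈ G := by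
    intro q
    simp only [hG, Set.mem_preimage, hBs, noRet, Set.mem_setOf_eq]
    refine forall_congr' fun s => forall_congr' fun _ => forall_congr' fun hs => ?_
    rw [walk_splice_le x m q s hs]
  have hbase : base = (μ G)⁻¹ • ((μ.prod μ).restrict (splice m ⁻¹' G)) := by
    have : splice m ⁻¹' G = G ×ˢ (Set.univ : Set (ℕ → Fin d × Bool)) := by
      ext q; simp [hmemG q]
    rw [this, ← Measure.prod_restrict, Measure.restrict_univ, ← Measure.prod_smul_left]
    rfl
  have hsplice : base.map (splice m) = ProbabilityTheory.cond μ G := by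
    rw [hbase, Measure.map_smul, ← Measure.restrict_map (measurable_splice m) hGm,
      splice_law hd m]
    rfl
  have hfst : Pi0.map Prod.fst = ProbabilityTheory.cond P Bs := by
    rw [Measure.map_map measurable_fst hΦm]
    have : Prod.fst ∘ Φ = walk x ∘ splice m := rfl
    rw [this, ← Measure.map_map hwm (measurable_splice m), hsplice]
    unfold ProbabilityTheory.cond
    rw [Measure.map_smul, ← Measure.restrict_map hwm hBsm, ← hPBs, ← hPeq]
  have hsnd : Pi0.map Prod.snd = P := by
    rw [Measure.map_map measurable_snd hΦm]
    have : Prod.snd ∘ Φ = walk x ∘ Prod.snd := rfl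
    rw [this, ← Measure.map_map hwm measurable_snd, Measure.map_snd_prod, measure_univ, one_smul,
      hPeq]
  have hrestr : (Pi0.map Prod.fst).restrict B = ((P Bs)⁻¹ * P B) • ProbabilityTheory.cond P B := by
    rw [hfst]
    unfold ProbabilityTheory.cond
    rw [Measure.restrict_smul, Measure.restrict_restrict hBm, Set.inter_eq_left.mpr hsub, smul_smul,
      mul_assoc, ENNReal.mul_inv_cancel hpos (measure_ne_top _ _), mul_one]
  obtain ⟨Q, hQ1, hQ2, hQ3⟩ := glue Pi0 (ProbabilityTheory.cond P B) P B hBm _ hrestr hsnd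
    measure_univ (goodEv l t)
  refine ⟨Q, hQ1, hQ2, hQ3.trans ?_⟩
  refine add_le_add le_rfl (add_le_add ?_ ?_)
  · -- displacement
    rw [Measure.map_apply hΦm (measurableSet_goodEv l t).compl]
    have hss : Φ ⁻¹' (goodEv l t)ᶜ ⊆ (farSet x m (l / 2) ×ˢ Set.univ) ∪
        (Set.univ ×ˢ farSet x m (l / 2)) := by
      intro q hq
      by_contra hcon
      simp only [Set.mem_union, Set.mem_prod, Set.mem_univ, and_true, true_and, not_or, farSet,
        Set.mem_setOf_eq, not_exists, not_and, not_lt] at hcon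
      obtain ⟨hc1, hc2⟩ := hcon
      apply hq
      have hclose : ∀ j ≤ m, ∀ i, |((walk x q.1 j i - walk x q.2 j i : ℤ) : ℝ)| ≤ l := by
        intro j hj i
        have a1 := hc1 j hj i
        have a2 := hc2 j hj i
        have e : ((walk x q.1 j i - walk x q.2 j i : ℤ) : ℝ)
          = ((walk x q.1 j i - x i : ℤ) : ℝ) - ((walk x q.2 j i - x i : ℤ) : ℝ) := by
          push_cast; ring
        rw [e]
        refine (abs_sub _ _).trans ?_
        linarith
      refine ⟨fun j i => ?_, fun j => ?_⟩
      · rcases le_total j m with hj | hj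
        · simp only [Φ]; rw [walk_splice_le x m q j hj]; exact hclose j hj i
        · obtain ⟨k, rfl⟩ := Nat.exists_eq_add_of_le hj
          have := congrFun (walk_splice_ge x m q k) i
          simp only [Pi.sub_apply] at this
          simp only [Φ]
          rw [this]; exact hclose m le_rfl i
      · obtain ⟨k, rfl⟩ := Nat.exists_eq_add_of_le hmt
        have e1 := walk_splice_ge x m q k
        have e2 := walk_splice_ge x m q (k + j)
        simp only [Φ]
        rw [add_assoc]
        rw [← e1] at e2
        rw [sub_eq_sub_iff_add_eq_add] at e2 ⊢
        rw [e2]; abel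
    refine (measure_mono hss).trans ((measure_union_le _ _).trans ?_)
    simp only [base]
    rw [Measure.prod_prod, Measure.prod_prod, measure_univ, measure_univ, mul_one, one_mul]
    refine add_le_add ?_ le_rfl
    rw [cond_apply hGm, ENNReal.div_eq_inv_mul]
    gcongr
    · rw [← hPBs]; exact measure_mono hsub
    · exact Set.inter_subset_right
  · rw [hfst, cond_apply hBsm, ENNReal.div_eq_inv_mul]
    rfl

theorem hitLate_le {d : ℕ} (hd : 0 < d) (x : Zd d) (P : Measure (ℕ → Zd d)) (hP : IsSRW d x P)
    (A : Finset (Zd d)) (m : ℕ) (b : ℕ → ℝ) (hb : ∀ t, m < t → ∀ y, hk d t y ≤ b t) :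
    P (noRet (A : Set (Zd d)) m \ NoReturn (A : Set (Zd d))) ≤
      ∑' t : ℕ, if m < t then (A.card : ℝ≥0∞) * ENNReal.ofReal (b t) else 0 := by
  have hPeq := srw_unique hd x P hP
  have hsub : noRet (A : Set (Zd d)) m \ NoReturn (A : Set (Zd d)) ⊆
      ⋃ t : ℕ, {ω | m < t ∧ ω t ∈ A} := by
    rintro ω ⟨h1, h2⟩
    simp only [NoReturn, Set.mem_setOf_eq, not_forall, not_not] at h2
    obtain ⟨t, ht, htA⟩ := h2
    rw [Set.mem_iUnion]
    refine ⟨t, ?_, htA⟩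
    by_contra hc
    exact h1 t ht (by omega) htA
  refine (measure_mono hsub).trans ((measure_iUnion_le _).trans ?_)
  refine ENNReal.tsum_le_tsum fun t => ?_
  split_ifs with h
  · have : {ω : ℕ → Zd d | m < t ∧ ω t ∈ A} ⊆ ⋃ y ∈ A, {ω | ω t = y} := by
      rintro ω ⟨_, hω⟩
      simp only [Set.mem_iUnion]
      exact ⟨ω t, hω, rfl⟩
    refine (measure_mono this).trans ((measure_biUnion_finset_le _ _).trans ?_)
    have : ∀ y ∈ A, P {ω | ω t = y} ≤ ENNReal.ofReal (b t) := by
      intro y _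
      have hms : MeasurableSet {ω : ℕ → Zd d | ω t = y} :=
        measurableSet_eq_fun (measurable_pi_apply t) measurable_const
      rw [hPeq, Measure.map_apply (measurable_walk x) hms]
      exact (walk_heat hd x t y).trans (ENNReal.ofReal_le_ofReal (hb t h _))
    refine (Finset.sum_le_sum this).trans ?_
    rw [Finset.sum_const, nsmul_eq_mul]
  · simp [h]

/-! ### Asymptotics -/

theorem hk_decay (d : ℕ) (hd : 5 ≤ d) : ∃ C : ℝ, 0 ≤ C ∧ ∀ t : ℕ, 1 ≤ t → ∀ y : Zd d,
    hk d t y ≤ C * (t : ℝ) ^ (-(5 / 2) : ℝ) := by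
  have hdpos : (0 : ℝ) < d := by positivity
  have hd5 : (5 : ℝ) ≤ d := by exact_mod_cast hd
  set r : ℝ := 1 - (1 / (2 * d : ℝ)) ^ 2 with hr
  have hδ : (1 / (2 * d : ℝ)) ^ 2 < 1 := by
    have h1 : (1 / (2 * d : ℝ)) < 1 := by rw [div_lt_one (by positivity)]; linarith
    have h0 : 0 ≤ (1 / (2 * d : ℝ)) := by positivity
    nlinarith
  have hr0 : 0 ≤ r := by linarith
  have hr1 : r < 1 := by
    have : 0 < (1 / (2 * d : ℝ)) ^ 2 := by positivity
    linarith
  have hsum : Summable (fun t : ℕ => (t : ℝ) ^ 3 * r ^ t) :=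
    summable_pow_mul_geometric_of_norm_lt_one 3 (by rwa [Real.norm_of_nonneg hr0])
  set K : ℝ := ∑' t : ℕ, (t : ℝ) ^ 3 * r ^ t with hK
  have hK0 : 0 ≤ K := tsum_nonneg fun t => by positivity
  refine ⟨(2 * d) ^ (5 / 2 : ℝ) + d * K, by positivity, fun t ht y => ?_⟩
  refine (hk_le d hd t y).trans ?_
  have htpos : (0 : ℝ) < t := by exact_mod_cast ht
  have ht1 : (1 : ℝ) ≤ t := by exact_mod_cast ht
  rw [add_mul]
  refine add_le_add ?_ ?_
  · have h1 : (1 / Real.sqrt (t / (2 * d) + 1)) ^ 5 = (t / (2 * d) + 1 : ℝ) ^ (-(5 / 2) : ℝ) := by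
      rw [Real.sqrt_eq_rpow, one_div, ← Real.rpow_neg (by positivity), ← Real.rpow_natCast,
        ← Real.rpow_mul (by positivity)]
      norm_num
    rw [h1]
    calc (t / (2 * d) + 1 : ℝ) ^ (-(5 / 2) : ℝ) ≤ (t / (2 * d) : ℝ) ^ (-(5 / 2) : ℝ) := by
          apply Real.rpow_le_rpow_of_nonpos (by positivity) (by linarith) (by norm_num)
      _ = _ := by
          rw [Real.div_rpow htpos.le (by positivity), Real.rpow_neg (by positivity : (0:ℝ) ≤ 2 * d)]
          field_simp
  · have h1 : (t : ℝ) ^ 3 * r ^ t ≤ K :=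
      hsum.le_tsum t fun j _ => by positivity
    have h2 : r ^ t ≤ K * (t : ℝ) ^ (-(5 / 2) : ℝ) := by
      have h3 : (t : ℝ) ^ (5 / 2 : ℝ) ≤ (t : ℝ) ^ 3 := by
        rw [← Real.rpow_natCast]
        exact Real.rpow_le_rpow_of_exponent_le ht1 (by norm_num)
      rw [Real.rpow_neg htpos.le, ← div_eq_mul_inv, le_div_iff₀ (by positivity)]
      calc r ^ t * (t : ℝ) ^ (5 / 2 : ℝ) ≤ r ^ t * (t : ℝ) ^ 3 := by gcongr
        _ ≤ K := by rw [mul_comm]; exact h1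
    calc d * r ^ t ≤ d * (K * (t : ℝ) ^ (-(5 / 2) : ℝ)) := by gcongr
      _ = _ := by ring

theorem hitLate_decay (d : ℕ) (hd : 5 ≤ d) : ∃ C : ℝ, 0 ≤ C ∧
    ∀ (x : Zd d) (P : Measure (ℕ → Zd d)), IsSRW d x P → ∀ (A : Finset (Zd d)) (m : ℕ), 1 ≤ m →
    P (noRet (A : Set (Zd d)) m \ NoReturn (A : Set (Zd d))) ≤
      ENNReal.ofReal (A.card * (C * (m : ℝ) ^ (-(14 / 10) : ℝ))) := by
  obtain ⟨C, hC, hdecay⟩ := hk_decay d hd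
  have hsum : Summable (fun t : ℕ => (t : ℝ) ^ (-(11 / 10) : ℝ)) :=
    Real.summable_nat_rpow.mpr (by norm_num)
  set K : ℝ := ∑' t : ℕ, (t : ℝ) ^ (-(11 / 10) : ℝ) with hK
  have hK0 : 0 ≤ K := tsum_nonneg fun t => by positivity
  refine ⟨C * K, by positivity, fun x P hP A m hm => ?_⟩
  have hmpos : (0 : ℝ) < m := by exact_mod_cast hm
  refine (hitLate_le (by omega) x P hP A m
    (fun t => C * (t : ℝ) ^ (-(5 / 2) : ℝ)) (fun t ht y => hdecay t (by omega) y)).trans ?_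
  calc _ ≤ ∑' t : ℕ, ENNReal.ofReal
        (A.card * (C * (m : ℝ) ^ (-(14 / 10) : ℝ)) * (t : ℝ) ^ (-(11 / 10) : ℝ)) := by
        refine ENNReal.tsum_le_tsum fun t => ?_
        split_ifs with h
        · rw [← ENNReal.ofReal_natCast, ← ENNReal.ofReal_mul (by positivity)]
          apply ENNReal.ofReal_le_ofReal
          rw [mul_assoc]
          refine mul_le_mul_of_nonneg_left ?_ (by positivity)
          rw [mul_assoc]
          refine mul_le_mul_of_nonneg_left ?_ hC
          have hmt : (m : ℝ) ≤ t := by exact_mod_cast h.le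
          have htpos : (0 : ℝ) < t := lt_of_lt_of_le hmpos hmt
          calc (t : ℝ) ^ (-(5 / 2) : ℝ) = (t : ℝ) ^ (-(14 / 10) : ℝ) * (t : ℝ) ^ (-(11 / 10) : ℝ) := by
                rw [← Real.rpow_add htpos]; norm_num
            _ ≤ _ := by
                refine mul_le_mul_of_nonneg_right ?_ (by positivity)
                exact Real.rpow_le_rpow_of_nonpos hmpos hmt (by norm_num)
        · exact zero_le
    _ = _ := by
        rw [← ENNReal.ofReal_tsum_of_nonneg (fun t => by positivity) (hsum.mul_left _), tsum_mul_left]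
        congr 1; rw [← hK]; ring

theorem far_mono {m M r r0 : ℝ} (hm : 0 ≤ m) (hmM : m ≤ M) (h0 : 0 ≤ r0) (hr : r0 ≤ r) :
    m * Real.exp (-r ^ 2 / (2 * m)) ≤ M * Real.exp (-r0 ^ 2 / (2 * M)) := by
  rcases hm.eq_or_lt with rfl | hm'
  · simp; positivity
  · have hM : 0 < M := lt_of_lt_of_le hm' hmM
    refine mul_le_mul hmM (Real.exp_le_exp.mpr ?_) (by positivity) hM.le
    rw [neg_div, neg_div, neg_le_neg_iff]
    gcongr

theorem Rn_tendsto (ρ : ℕ → ℕ → ℝ) (hρ : Appropriate ρ) :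
    Tendsto (fun n => (Rn ρ n : ℝ)) atTop atTop := by
  have h1 : Tendsto (fun n => Real.sqrt (mu 1 (ρ n))) atTop atTop :=
    Real.tendsto_sqrt_atTop.comp hρ.2.2.1
  exact tendsto_natCast_atTop_atTop.comp ((tendsto_nat_floor_atTop (α := ℝ)).comp h1)

theorem asym5 (θ2 KK C D : ℝ) :
    ∀ᶠ R : ℝ in atTop,
      (1 / θ2 + 1) * (D * (R ^ (3 / 2 : ℝ) *
        Real.exp (-(R ^ (99 / 100 : ℝ) / 4) ^ 2 / (2 * R ^ (3 / 2 : ℝ))))) +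
      (KK * R ^ 2 + 1) * (C * (R ^ (3 / 2 : ℝ) / 2) ^ (-(14 / 10) : ℝ)) / θ2
        ≤ R ^ (-(cConst / 2)) := by
  have hT1 : Tendsto (fun R : ℝ => (R ^ (12 / 25 : ℝ)) ^ (301 / 96 : ℝ) *
      Real.exp (-(1 / 32) * R ^ (12 / 25 : ℝ))) atTop (𝓝 0) :=
    (tendsto_rpow_mul_exp_neg_mul_atTop_nhds_zero (301 / 96) (1 / 32) (by norm_num)).comp
      (tendsto_rpow_atTop (by norm_num : (0 : ℝ) < 12 / 25))
  have hT2 : Tendsto (fun R : ℝ => R ^ (-(19 / 200) : ℝ)) atTop (𝓝 0) :=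
    tendsto_rpow_neg_atTop (by norm_num)
  have hT3 : Tendsto (fun R : ℝ => R ^ (-(419 / 200) : ℝ)) atTop (𝓝 0) :=
    tendsto_rpow_neg_atTop (by norm_num)
  have hT := ((hT1.const_mul ((1 / θ2 + 1) * D))).add
    (((hT2.const_mul KK).add hT3).const_mul (C * 2 ^ (14 / 10 : ℝ) / θ2))
  simp only [mul_zero, add_zero] at hT
  have hev := hT.eventually_lt_const (show (0 : ℝ) < 1 by norm_num)
  filter_upwards [hev, eventually_gt_atTop 0] with R h hR
  rw [show cConst / 2 = 1 / 200 by norm_num [cConst], Real.rpow_neg hR.le, ← one_div,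
    le_div_iff₀ (by positivity)]
  refine le_trans (le_of_eq ?_) h.le
  have e1 : (R ^ (12 / 25 : ℝ)) ^ (301 / 96 : ℝ) = R ^ (3 / 2 : ℝ) * R ^ (1 / 200 : ℝ) := by
    rw [← Real.rpow_mul hR.le, ← Real.rpow_add hR]; norm_num
  have e2 : -(R ^ (99 / 100 : ℝ) / 4) ^ 2 / (2 * R ^ (3 / 2 : ℝ)) = -(1 / 32) * R ^ (12 / 25 : ℝ) := by
    have : (R ^ (99 / 100 : ℝ)) ^ 2 = R ^ (3 / 2 : ℝ) * R ^ (12 / 25 : ℝ) := by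
      rw [← Real.rpow_natCast, ← Real.rpow_mul hR.le, ← Real.rpow_add hR]; norm_num
    rw [div_pow, this]
    field_simp; norm_num
  have e3 : (R ^ (3 / 2 : ℝ) / 2) ^ (-(14 / 10) : ℝ) = 2 ^ (14 / 10 : ℝ) * R ^ (-(21 / 10) : ℝ) := by
    rw [Real.div_rpow (by positivity) (by norm_num), ← Real.rpow_mul hR.le,
      Real.rpow_neg (by norm_num : (0 : ℝ) ≤ 2)]
    rw [div_inv_eq_mul, mul_comm]; norm_num
  have e4 : R ^ (-(419 / 200) : ℝ) = R ^ (-(21 / 10) : ℝ) * R ^ (1 / 200 : ℝ) := by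
    rw [← Real.rpow_add hR]; norm_num
  have e5 : R ^ (-(19 / 200) : ℝ) = R ^ 2 * R ^ (-(21 / 10) : ℝ) * R ^ (1 / 200 : ℝ) := by
    rw [← Real.rpow_natCast, ← Real.rpow_add hR, ← Real.rpow_add hR]; norm_num
  rw [e1, e2, e3, e4, e5]
  ring

theorem asym4 (θ1 θ2 D : ℝ) (hθ1 : 0 < θ1) (hθ2 : 0 < θ2) (hD : 0 ≤ D) :
    ∀ᶠ R : ℝ in atTop,
      (3 * Real.log R / θ2 + 1) * (D * (R ^ 2 / Real.log R ^ 10 *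
        Real.exp (-(R * Real.log R ^ (-(2 * cConst)) / 4) ^ 2 / (2 * (R ^ 2 / Real.log R ^ 10)))))
        ≤ θ1 := by
  have hT1 : Tendsto (fun L : ℝ => L ^ 1 * Real.exp (-L)) atTop (𝓝 0) :=
    Real.tendsto_pow_mul_exp_neg_atTop_nhds_zero 1
  have hT0 : Tendsto (fun L : ℝ => L ^ 0 * Real.exp (-L)) atTop (𝓝 0) :=
    Real.tendsto_pow_mul_exp_neg_atTop_nhds_zero 0
  have hT := ((hT1.const_mul (3 / θ2)).add hT0).const_mul D
  simp only [mul_zero, add_zero] at hT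
  have hev := (hT.comp Real.tendsto_log_atTop).eventually_lt_const hθ1
  filter_upwards [hev, eventually_gt_atTop 1, Real.tendsto_log_atTop.eventually_ge_atTop 96]
    with R h hR hL
  simp only [Function.comp] at h
  refine le_trans ?_ h.le
  have hR0 : 0 < R := by linarith
  set L := Real.log R with hLdef
  have hRexp : R = Real.exp L := (Real.exp_log hR0).symm
  have hL0 : 0 < L := by linarith
  have hL1 : 1 ≤ L := by linarith
  have e1 : -(R * L ^ (-(2 * cConst)) / 4) ^ 2 / (2 * (R ^ 2 / L ^ 10)) =
      -((L ^ (-(2 * cConst))) ^ 2 * L ^ 10) / 32 := by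
    field_simp; norm_num
  have e2 : L ^ 2 ≤ (L ^ (-(2 * cConst))) ^ 2 * L ^ 10 := by
    rw [← Real.rpow_natCast, ← Real.rpow_natCast (L ^ (-(2 * cConst))), ← Real.rpow_natCast L 10,
      ← Real.rpow_mul hL0.le, ← Real.rpow_add hL0]
    exact Real.rpow_le_rpow_of_exponent_le hL1 (by norm_num [cConst])
  have e3 : R ^ 2 / L ^ 10 * Real.exp (-((L ^ (-(2 * cConst))) ^ 2 * L ^ 10) / 32) ≤
      Real.exp (-L) := by
    calc _ ≤ R ^ 2 * Real.exp (-(L ^ 2) / 32) := by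
          refine mul_le_mul ?_ (Real.exp_le_exp.mpr (by linarith)) (by positivity) (by positivity)
          exact div_le_self (by positivity) (one_le_pow₀ hL1)
      _ = Real.exp (2 * L + -(L ^ 2) / 32) := by
          rw [hRexp, ← Real.exp_nat_mul, ← Real.exp_add]; norm_num
      _ ≤ _ := Real.exp_le_exp.mpr (by nlinarith)
  rw [e1]
  calc _ ≤ (3 * L / θ2 + 1) * (D * Real.exp (-L)) := by gcongr
    _ = _ := by ring

theorem half_floor {y : ℝ} (hy : 2 ≤ y) : y / 2 ≤ (⌊y⌋₊ : ℝ) := by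
  have := Nat.lt_floor_add_one y
  linarith

/-- Final assembly with real error bounds. -/
theorem assemble {d : ℕ} (hd : 0 < d) (x : Zd d) (P : Zd d → Measure (ℕ → Zd d))
    (hP : IsSRWFamily d P) (A : Set (Zd d)) (hx : x ∈ A) (m t : ℕ) (hmt : m ≤ t) (l : ℝ)
    (M l0 e0 κ ξ : ℝ) (hl0 : 0 ≤ l0) (hl : l0 ≤ l / 2) (hM : (m : ℝ) ≤ M) (he0 : 0 < e0)
    (he : e0 ≤ equil P A x)
    (hκ0 : 0 ≤ κ)
    (hκ : P x (noRet A m \ NoReturn A) / P x (noRet A m) ≤ ENNReal.ofReal κ)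
    (hξ : (1 / e0 + 1) * (2 * d * (M * Real.exp (-l0 ^ 2 / (2 * M)))) + κ ≤ ξ) :
    ∃ Q : Measure ((ℕ → Zd d) × (ℕ → Zd d)),
      Q.map Prod.fst = ProbabilityTheory.cond (P x) (NoReturn A) ∧ Q.map Prod.snd = P x ∧
      ENNReal.ofReal (1 - ξ) ≤ Q (goodEv l t) := by
  have hprob := (hP x).1
  rw [equil, if_pos hx] at he
  have hpos : P x (NoReturn A) ≠ 0 := by
    intro h; rw [h] at he; simp at he; linarith
  obtain ⟨Q, h1, h2, h3⟩ := core_coupling hd x (P x) (hP x) A m t hmt l (by linarith) hpos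
  refine ⟨Q, h1, h2, ?_⟩
  set f : ℝ := 2 * d * (M * Real.exp (-l0 ^ 2 / (2 * M))) with hf
  have hM0 : 0 ≤ M := le_trans (Nat.cast_nonneg _) hM
  have hf0 : 0 ≤ f := by positivity
  have hfar : stepLaw d (farSet x m (l / 2)) ≤ ENNReal.ofReal f := by
    refine (farSet_le hd x m (l / 2) (by linarith)).trans (ENNReal.ofReal_le_ofReal ?_)
    rw [hf, mul_assoc (2 * (d : ℝ))]
    exact mul_le_mul_of_nonneg_left (far_mono (Nat.cast_nonneg _) hM hl0 hl) (by positivity)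
  have hea : ENNReal.ofReal e0 ≤ P x (NoReturn A) := by
    rw [← ENNReal.ofReal_toReal (measure_ne_top (P x) (NoReturn A))]
    exact ENNReal.ofReal_le_ofReal he
  have hX : (stepLaw d (farSet x m (l / 2)) / P x (NoReturn A)
        + stepLaw d (farSet x m (l / 2))) + P x (noRet A m \ NoReturn A) / P x (noRet A m)
      ≤ ENNReal.ofReal ξ := by
    calc _ ≤ (ENNReal.ofReal f / ENNReal.ofReal e0 + ENNReal.ofReal f) + ENNReal.ofReal κ := by
          gcongr
      _ = ENNReal.ofReal ((1 / e0 + 1) * f + κ) := by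
          rw [← ENNReal.ofReal_div_of_pos he0, ← ENNReal.ofReal_add (by positivity) hf0,
            ← ENNReal.ofReal_add (by positivity) hκ0]
          congr 1; ring
      _ ≤ _ := ENNReal.ofReal_le_ofReal hξ
  have hξ0 : 0 ≤ ξ := le_trans (by positivity) hξ
  rw [ENNReal.ofReal_sub _ hξ0, ENNReal.ofReal_one]
  rw [tsub_le_iff_right]
  exact h3.trans (by gcongr)

theorem final5 (d : ℕ) (hd : 5 ≤ d)
    (ρ : ℕ → ℕ → ℝ) (hρ : Appropriate ρ)
    (Pw : Zd d → Measure (ℕ → Zd d)) (hPw : IsSRWFamily d Pw)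
    (KK θ2 : ℝ) (hθ2 : 0 < θ2) :
    ∀ᶠ n in atTop, ∀ η : Traj d, η ≠ [] → (len η : ℝ) ≤ KK * (Rn ρ n : ℝ) ^ 2 →
      ∀ x : Zd d, x ∈ rangeSet η → θ2 ≤ equil Pw (rangeSet η) x →
      ∃ Q : Measure ((ℕ → Zd d) × (ℕ → Zd d)),
        Q.map Prod.fst = ProbabilityTheory.cond (Pw x) (NoReturn (rangeSet η)) ∧
        Q.map Prod.snd = Pw x ∧
        ENNReal.ofReal (1 - (Rn ρ n : ℝ) ^ (-(cConst / 2))) ≤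
          Q (goodEv (⌊(Rn ρ n : ℝ) ^ ((1 : ℝ) - cConst / 4)⌋₊ : ℝ)
            ⌊(Rn ρ n : ℝ) ^ ((2 : ℝ) - cConst)⌋₊) := by
  obtain ⟨C, hC, hlate⟩ := hitLate_decay d hd
  have hR := Rn_tendsto ρ hρ
  filter_upwards [hR.eventually (asym5 θ2 KK C (2 * d)),
    hR.eventually_ge_atTop 4] with n hasy hR4 η hη hlen x hx he
  set R : ℝ := (Rn ρ n : ℝ) with hRdef
  have hR0 : 0 < R := by linarith
  have hR1 : 1 ≤ R := by linarith
  have h32 : R ≤ R ^ (3 / 2 : ℝ) := by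
    conv_lhs => rw [← Real.rpow_one R]
    exact Real.rpow_le_rpow_of_exponent_le hR1 (by norm_num)
  have hA : rangeSet η = ((η.toFinset : Finset (Zd d)) : Set (Zd d)) := by
    ext y; simp [rangeSet]
  have hm : R ^ (3 / 2 : ℝ) / 2 ≤ (⌊R ^ (3 / 2 : ℝ)⌋₊ : ℝ) := half_floor (by linarith)
  have hm1 : 1 ≤ ⌊R ^ (3 / 2 : ℝ)⌋₊ := Nat.le_floor (by push_cast; linarith)
  have hcard : ((η.toFinset.card : ℕ) : ℝ) ≤ KK * R ^ 2 + 1 := by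
    have h1 : η.toFinset.card ≤ len η + 1 := by
      have := List.toFinset_card_le η
      have : 0 < η.length := List.length_pos_iff.mpr hη
      unfold len; omega
    have h2 : ((η.toFinset.card : ℕ) : ℝ) ≤ (len η : ℝ) + 1 := by exact_mod_cast h1
    linarith
  have hKK0 : 0 ≤ KK * R ^ 2 + 1 := le_trans (by positivity) hcard
  have h99 : (2:ℝ) ≤ R ^ (99 / 100 : ℝ) := by
    calc (2:ℝ) = 4 ^ (1 / 2 : ℝ) := by
          rw [show (4:ℝ) = 2 ^ (2:ℝ) by norm_num, ← Real.rpow_mul (by norm_num)]; norm_num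
      _ ≤ R ^ (1 / 2 : ℝ) := Real.rpow_le_rpow (by norm_num) hR4 (by norm_num)
      _ ≤ _ := Real.rpow_le_rpow_of_exponent_le hR1 (by norm_num)
  have h99' : R ^ (99 / 100 : ℝ) ≤ R ^ ((1 : ℝ) - cConst / 4) :=
    Real.rpow_le_rpow_of_exponent_le hR1 (by norm_num [cConst])
  have hprob := (hPw x).1
  have hle := hlate x (Pw x) (hPw x) η.toFinset _ hm1
  rw [← hA] at hle
  refine assemble (by omega) x Pw hPw (rangeSet η) hx ⌊R ^ (3 / 2 : ℝ)⌋₊ _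
    (Nat.floor_mono (Real.rpow_le_rpow_of_exponent_le hR1 (by norm_num [cConst]))) _
    (R ^ (3 / 2 : ℝ)) (R ^ (99 / 100 : ℝ) / 4) θ2
    ((KK * R ^ 2 + 1) * (C * (R ^ (3 / 2 : ℝ) / 2) ^ (-(14 / 10) : ℝ)) / θ2) _
    (by positivity) ?_ (Nat.floor_le (by positivity)) hθ2 he (by positivity) ?_ hasy
  · have := half_floor (le_trans h99 h99')
    linarith
  · have hden : ENNReal.ofReal θ2 ≤ Pw x (noRet (rangeSet η) ⌊R ^ (3 / 2 : ℝ)⌋₊) := by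
      rw [equil, if_pos hx] at he
      refine (ENNReal.ofReal_le_ofReal he).trans ?_
      rw [ENNReal.ofReal_toReal (measure_ne_top _ _)]
      exact measure_mono fun ω hω t ht _ => hω t ht
    rw [ENNReal.ofReal_div_of_pos hθ2]
    refine ENNReal.div_le_div (hle.trans (ENNReal.ofReal_le_ofReal ?_)) hden
    refine mul_le_mul hcard ?_ (by positivity) hKK0
    refine mul_le_mul_of_nonneg_left ?_ hC
    exact Real.rpow_le_rpow_of_nonpos (by positivity) hm (by norm_num)

theorem final4 (d : ℕ) (hd : 4 ≤ d)
    (ρ : ℕ → ℕ → ℝ) (hρ : Appropriate ρ)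
    (Pw : Zd d → Measure (ℕ → Zd d)) (hPw : IsSRWFamily d Pw)
    (θ1 θ2 : ℝ) (hθ1 : 0 < θ1) (hθ2 : 0 < θ2) :
    ∀ᶠ n in atTop, ∀ η : Traj d,
      ∀ x : Zd d, x ∈ rangeSet η → θ2 / Real.log (mu 1 (ρ n)) ≤ equil Pw (rangeSet η) x →
        (Pw x (NoReturnUpTo (rangeSet η)
            ((Rn ρ n : ℝ) ^ 2 / (Real.log (Rn ρ n)) ^ (10 : ℕ)))).toReal ≤
          (1 + θ1) * equil Pw (rangeSet η) x →
      ∃ Q : Measure ((ℕ → Zd d) × (ℕ → Zd d)),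
        Q.map Prod.fst = ProbabilityTheory.cond (Pw x) (NoReturn (rangeSet η)) ∧
        Q.map Prod.snd = Pw x ∧
        ENNReal.ofReal (1 - 2 * θ1) ≤
          Q (goodEv (⌊(Rn ρ n : ℝ) * (Real.log (Rn ρ n)) ^ (-(2 * cConst))⌋₊ : ℝ)
            ⌊(Rn ρ n : ℝ) ^ (2 : ℕ) / (Real.log (Rn ρ n)) ^ (10 : ℕ)⌋₊) := by
  have hR := Rn_tendsto ρ hρ
  filter_upwards [hR.eventually (asym4 θ1 θ2 (2 * d) hθ1 hθ2 (by positivity)),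
    hR.eventually_ge_atTop 16, (Real.tendsto_log_atTop.comp hR).eventually_ge_atTop 2,
    hρ.2.2.1.eventually_gt_atTop 1] with n hasy hR4 hlog hmu η x hx he hb
  simp only [Function.comp] at hlog
  have hmuR : mu 1 (ρ n) ≤ ((Rn ρ n : ℝ) + 1) ^ 2 := by
    have h1 : Real.sqrt (mu 1 (ρ n)) < (Rn ρ n : ℝ) + 1 := Nat.lt_floor_add_one _
    have h2 := Real.sq_sqrt (show 0 ≤ mu 1 (ρ n) by linarith)
    have h3 := Real.sqrt_nonneg (mu 1 (ρ n))
    nlinarith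
  set R : ℝ := (Rn ρ n : ℝ) with hRdef
  have hR0 : 0 < R := by linarith
  have hR1 : 1 ≤ R := by linarith
  have hlogmu : 0 < Real.log (mu 1 (ρ n)) := Real.log_pos hmu
  have hlogle : Real.log (mu 1 (ρ n)) ≤ 3 * Real.log R := by
    have : Real.log (mu 1 (ρ n)) ≤ Real.log (R ^ 3) := by
      refine Real.log_le_log (by linarith) (hmuR.trans ?_)
      nlinarith [mul_pos hR0 hR0]
    rwa [Real.log_pow] at this
  have hl2 : 2 ≤ R * Real.log R ^ (-(2 * cConst)) := by
    have h1 : Real.log R ≤ R := (Real.log_le_self hR0.le)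
    have h2 : R ^ (-(2 * cConst)) ≤ Real.log R ^ (-(2 * cConst)) :=
      Real.rpow_le_rpow_of_nonpos (by linarith) h1 (by norm_num [cConst])
    have h3 : R ^ (-(1 / 2) : ℝ) ≤ R ^ (-(2 * cConst)) :=
      Real.rpow_le_rpow_of_exponent_le hR1 (by norm_num [cConst])
    have h4 : R * R ^ (-(1 / 2) : ℝ) = R ^ (1 / 2 : ℝ) := by
      conv_lhs => rw [← Real.rpow_one R, ← Real.rpow_mul hR0.le, one_mul, ← Real.rpow_add hR0]
      norm_num
    have h5 : (2:ℝ) ≤ R ^ (1 / 2 : ℝ) := by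
      rw [← Real.sqrt_eq_rpow]
      exact Real.le_sqrt_of_sq_le (by linarith)
    have h6 := mul_le_mul_of_nonneg_left (h3.trans h2) hR0.le
    linarith
  have hprob := (hPw x).1
  set m := ⌊R ^ (2 : ℕ) / (Real.log R) ^ (10 : ℕ)⌋₊ with hmdef
  have hMnn : 0 ≤ R ^ (2 : ℕ) / (Real.log R) ^ (10 : ℕ) := by positivity
  have hnr : NoReturnUpTo (rangeSet η) (R ^ 2 / (Real.log R) ^ (10 : ℕ)) =
      noRet (rangeSet η) m := by
    ext ω
    simp only [NoReturnUpTo, noRet, Set.mem_setOf_eq, hmdef, Nat.le_floor_iff hMnn]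
  rw [hnr] at hb
  have hepos : 0 < θ2 / Real.log (mu 1 (ρ n)) := by positivity
  refine assemble (by omega) x Pw hPw (rangeSet η) hx m m le_rfl _
    (R ^ (2 : ℕ) / (Real.log R) ^ (10 : ℕ)) (R * Real.log R ^ (-(2 * cConst)) / 4)
    (θ2 / Real.log (mu 1 (ρ n))) θ1 _
    (by linarith) ?_ (Nat.floor_le hMnn) hepos he hθ1.le ?_ ?_
  · have := half_floor hl2
    linarith
  · have hsub : NoReturn (rangeSet η) ⊆ noRet (rangeSet η) m := fun ω hω t ht _ => hω t ht
    rw [equil, if_pos hx] at hb he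
    have hle := ENNReal.toReal_mono (measure_ne_top (Pw x) _) (measure_mono (μ := Pw x) hsub)
    rw [measure_diff hsub (measurableSet_noReturn _).nullMeasurableSet (measure_ne_top _ _)]
    set a := Pw x (NoReturn (rangeSet η)) with ha
    set b := Pw x (noRet (rangeSet η) m) with hbb
    have hat : a ≠ ∞ := measure_ne_top _ _
    have hbt : b ≠ ∞ := measure_ne_top _ _
    have hb0 : 0 < b.toReal := by linarith
    refine ENNReal.div_le_of_le_mul ?_
    rw [← ENNReal.ofReal_toReal hbt, ← ENNReal.ofReal_toReal hat,
      ← ENNReal.ofReal_sub _ ENNReal.toReal_nonneg, ← ENNReal.ofReal_mul hθ1.le]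
    refine ENNReal.ofReal_le_ofReal ?_
    nlinarith
  · have h1 : 1 / (θ2 / Real.log (mu 1 (ρ n))) ≤ 3 * Real.log R / θ2 := by
      rw [one_div_div]; gcongr
    have h2 := mul_le_mul_of_nonneg_right (add_le_add_left h1 1) (show 0 ≤ 2 * (d:ℝ) * (R ^ 2 / Real.log R ^ 10 *
        Real.exp (-(R * Real.log R ^ (-(2 * cConst)) / 4) ^ 2 / (2 * (R ^ 2 / Real.log R ^ 10)))) by
        positivity)
    linarith

/-- **Lemma 4.2 (forgetting the conditioning).** For all large `n`, every typical
trajectory `η ∈ 𝒯_n` and every `x` in its `*`-proper part `η̂`, there is a coupling `Q`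
of `X¹ ∼ P^x[·|H̃_{range η} = ∞]` and `X² ∼ P^x` such that the event
`E = {|X¹_j - X²_j|_∞ ≤ l_n ∀j} ∩ {X¹[t_n,∞) ≃ X²[t_n,∞)}` has
`Q[E] ≥ 1 - R_n^{-c/2}` when `d ≥ 5`, and `Q[E] ≥ 1 - 2θ₁` when `d = 4`. -/
theorem coupling_conditioned_walk
    (d : ℕ) (hd : 4 ≤ d)
    (ρ : ℕ → ℕ → ℝ) (hρ : Appropriate ρ)
    (Pw : Zd d → Measure (ℕ → Zd d)) (hPw : IsSRWFamily d Pw)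
    (εd : ℝ) (hεd : IsCapLimit d Pw εd)
    (kk KK M θ1 θ2 : ℝ) (hkk : 0 < kk) (hKK : 0 < KK) (hM : 0 < M)
    (hθ1 : θ1 ∈ Set.Ioo (0 : ℝ) 1) (hθ2 : θ2 ∈ Set.Ioo (0 : ℝ) 1) :
    ∀ᶠ n in atTop, ∀ η : Traj d, Typical d Pw εd ρ kk KK M θ1 n η →
      ∀ x : Zd d, ProperStar d Pw ρ θ1 θ2 n η x →
      ∃ Q : Measure ((ℕ → Zd d) × (ℕ → Zd d)),
        Q.map Prod.fst = ProbabilityTheory.cond (Pw x) (NoReturn (rangeSet η)) ∧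
        Q.map Prod.snd = Pw x ∧
        ENNReal.ofReal
            (if d = 4 then 1 - 2 * θ1 else 1 - (Rn ρ n : ℝ) ^ (-(cConst / 2))) ≤
          Q {p | (∀ j : ℕ, ∀ i, |((p.1 j i - p.2 j i : ℤ) : ℝ)| ≤ (lnPar d ρ n : ℝ)) ∧
              ∀ j : ℕ, p.1 (tnPar d ρ n + j) - p.1 (tnPar d ρ n) =
                p.2 (tnPar d ρ n + j) - p.2 (tnPar d ρ n)} := by
  by_cases h4 : d = 4
  · filter_upwards [final4 d hd ρ hρ Pw hPw θ1 θ2 hθ1.1 hθ2.1] with n hn η _ x hx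
    obtain ⟨hx1, hx2⟩ := hx
    rw [if_pos h4] at hx2
    have := hn η x hx1 hx2.1 hx2.2
    simpa only [goodEv, lnPar, tnPar, if_pos h4] using this
  · filter_upwards [final5 d (by omega) ρ hρ Pw hPw KK θ2 hθ2.1] with n hn η hη x hx
    obtain ⟨hx1, hx2⟩ := hx
    rw [if_neg h4] at hx2
    have := hn η hη.1.1 hη.2.1.2.1 x hx1 hx2
    simpa only [goodEv, lnPar, tnPar, if_neg h4] using this

end FRIPaper
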